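/- arXiv:1411.5326 — 12 statements merged into one kernel-verified Lean document; each statement's English description precedes it below -/
import Mathlib

section
/- Let X and U be finite nonempty types, P a transition matrix on X, and Q : X → X → U → ℝ an output kernel. If P is irreducible on X, then the augmented transition function P̃ is irreducible on the augmented state space Y, i.e., for all (x,u), (x',u') ∈ Y there exists n ≥ 1 with P̃^n (x,u) (x',u') > 0. -/
/-- If the transition matrix `P` on `X` is irreducible, then the augmented transition
function `P̃ (x,u) (x',u') := P x x' * Q x x' u'` is irreducible on the augmented
state space `Y := {(x,u) : ∃ x₀, P x₀ x * Q x₀ x u > 0}`. -/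
theorem stmt_2 {X U : Type*} [Fintype X] [Fintype U] [Nonempty X] [Nonempty U]
    [DecidableEq X] [DecidableEq U]
    (P : Matrix X X ℝ) (Q : X → X → U → ℝ)
    (hPnn : ∀ x x' : X, 0 ≤ P x x')
    (hProw : ∀ x : X, ∑ x' : X, P x x' = 1)
    (hQnn : ∀ (x x' : X) (u : U), 0 ≤ Q x x' u)
    (hQrow : ∀ x x' : X, ∑ u : U, Q x x' u = 1)
    (hirr : ∀ x x' : X, ∃ n : ℕ, 1 ≤ n ∧ 0 < (P ^ n) x x')
    (Y : Set (X × U)) (hY : Y = {y : X × U | ∃ x₀ : X, 0 < P x₀ y.1 * Q x₀ y.1 y.2})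
    (Pt : Matrix (X × U) (X × U) ℝ)
    (hPt : Pt = Matrix.of fun y y' : X × U => P y.1 y'.1 * Q y.1 y'.1 y'.2) :
    ∀ y ∈ Y, ∀ y' ∈ Y, ∃ n : ℕ, 1 ≤ n ∧ 0 < (Pt ^ n) y y' := by
  have step : ∀ (n : ℕ), (∀ (y : X × U) (x' : X), ∑ u : U, (Pt ^ n) y (x', u) = (P ^ n) y.1 x') →
      ∀ y y' : X × U, (Pt ^ (n + 1)) y y' =
        ∑ x₁ : X, (P ^ n) y.1 x₁ * (P x₁ y'.1 * Q x₁ y'.1 y'.2) := by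
    intro n h y y'
    rw [pow_succ, Matrix.mul_apply, Fintype.sum_prod_type]
    refine Finset.sum_congr rfl fun x₁ _ => ?_
    rw [← h y x₁, Finset.sum_mul]
    refine Finset.sum_congr rfl fun u _ => ?_
    congr 1
    rw [hPt]
    rfl
  have key : ∀ (n : ℕ) (y : X × U) (x' : X),
      ∑ u : U, (Pt ^ n) y (x', u) = (P ^ n) y.1 x' := by
    intro n
    induction n with
    | zero =>
      rintro ⟨x, v⟩ x'
      by_cases hx : x = x' <;> simp [Matrix.one_apply, hx]
    | succ n ih =>
      intro y x'
      simp_rw [step n ih]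
      rw [Finset.sum_comm, pow_succ, Matrix.mul_apply]
      refine Finset.sum_congr rfl fun x₁ _ => ?_
      rw [← Finset.mul_sum, ← Finset.mul_sum, hQrow, mul_one]
  have nn : ∀ (n : ℕ) (x x' : X), 0 ≤ (P ^ n) x x' := by
    intro n
    induction n with
    | zero =>
      intro x x'
      rw [pow_zero, Matrix.one_apply]
      split_ifs <;> norm_num
    | succ n ih =>
      intro x x'
      rw [pow_succ, Matrix.mul_apply]
      exact Finset.sum_nonneg fun z _ => mul_nonneg (ih _ _) (hPnn _ _)
  intro y _ y' hy'
  rw [hY] at hy'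
  obtain ⟨x₀, h0⟩ := hy'
  obtain ⟨n, _, hn⟩ := hirr y.1 x₀
  refine ⟨n + 1, by omega, ?_⟩
  rw [step n (key n)]
  exact Finset.sum_pos' (fun z _ => mul_nonneg (nn _ _ _) (mul_nonneg (hPnn _ _) (hQnn _ _ _)))
    ⟨x₀, Finset.mem_univ _, mul_pos hn h0⟩
end

section
/- Let X and U be finite nonempty types, P a transition matrix on X, and Q : X → X → U → ℝ an output kernel. If P is irreducible and aperiodic on X, then the augmented transition function P̃ is aperiodic on the augmented state space Y, i.e., for every (x,u) ∈ Y, gcd{n ≥ 1 : P̃^n (x,u) (x,u) > 0} = 1. -/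
/-- The greatest common divisor of a set of natural numbers, defined as the
supremum of the set of common divisors.  For a set containing a positive
element this coincides with the usual gcd; for the empty set it equals `0`. -/
noncomputable def setGcd (S : Set ℕ) : ℕ := sSup {d : ℕ | ∀ n ∈ S, d ∣ n}

/-- If the transition matrix `P` on `X` is irreducible and aperiodic, then the augmented
transition function `P̃ (x,u) (x',u') := P x x' * Q x x' u'` is aperiodic on the
augmented state space `Y := {(x,u) : ∃ x₀, P x₀ x * Q x₀ x u > 0}`. -/
theorem stmt_3 {X U : Type*} [Fintype X] [Fintype U] [Nonempty X] [Nonempty U]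
    [DecidableEq X] [DecidableEq U]
    (P : Matrix X X ℝ) (Q : X → X → U → ℝ)
    (hPnn : ∀ x x' : X, 0 ≤ P x x')
    (hProw : ∀ x : X, ∑ x' : X, P x x' = 1)
    (hQnn : ∀ (x x' : X) (u : U), 0 ≤ Q x x' u)
    (hQrow : ∀ x x' : X, ∑ u : U, Q x x' u = 1)
    (hirr : ∀ x x' : X, ∃ n : ℕ, 1 ≤ n ∧ 0 < (P ^ n) x x')
    (hap : ∀ x : X, setGcd {n : ℕ | 1 ≤ n ∧ 0 < (P ^ n) x x} = 1)
    (Y : Set (X × U)) (hY : Y = {y : X × U | ∃ x₀ : X, 0 < P x₀ y.1 * Q x₀ y.1 y.2})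
    (Pt : Matrix (X × U) (X × U) ℝ)
    (hPt : Pt = Matrix.of fun y y' : X × U => P y.1 y'.1 * Q y.1 y'.1 y'.2) :
    ∀ y ∈ Y, setGcd {n : ℕ | 1 ≤ n ∧ 0 < (Pt ^ n) y y} = 1 := by
  classical
  have hmarg : ∀ (n : ℕ) (y : X × U) (x' : X), ∑ u', (Pt ^ n) y (x', u') = (P ^ n) y.1 x' := by
    intro n
    induction n with
    | zero =>
      rintro ⟨x, u⟩ x'
      by_cases h : x = x'
      · subst h
        simp [Matrix.one_apply]
      · simp [Matrix.one_apply, h]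
    | succ n ih =>
      intro y x'
      simp only [pow_succ, Matrix.mul_apply]
      rw [Finset.sum_comm, Fintype.sum_prod_type]
      refine Finset.sum_congr rfl fun x₀ _ => ?_
      rw [← ih y x₀, Finset.sum_mul]
      refine Finset.sum_congr rfl fun u₀ _ => ?_
      rw [← Finset.mul_sum]
      congr 1
      simp only [hPt, Matrix.of_apply]
      rw [← Finset.mul_sum, hQrow, mul_one]
  have hstep : ∀ (n : ℕ) (y y' : X × U), (Pt ^ (n + 1)) y y'
      = ∑ x₀, (P ^ n) y.1 x₀ * (P x₀ y'.1 * Q x₀ y'.1 y'.2) := by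
    intro n y y'
    rw [pow_succ, Matrix.mul_apply, Fintype.sum_prod_type]
    refine Finset.sum_congr rfl fun x₀ _ => ?_
    rw [← hmarg n y x₀, Finset.sum_mul]
    refine Finset.sum_congr rfl fun u₀ _ => ?_
    simp only [hPt, Matrix.of_apply]
  have hpow : ∀ (n : ℕ) (x x' : X), 0 ≤ (P ^ n) x x' := by
    intro n
    induction n with
    | zero =>
      intro x x'
      rw [pow_zero, Matrix.one_apply]
      split_ifs <;> norm_num
    | succ n ih =>
      intro x x'
      rw [pow_succ, Matrix.mul_apply]
      exact Finset.sum_nonneg fun i _ => mul_nonneg (ih _ _) (hPnn _ _)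
  have hadd : ∀ (m n : ℕ) (x z w : X), 0 < (P ^ m) x z → 0 < (P ^ n) z w →
      0 < (P ^ (m + n)) x w := by
    intro m n x z w h1 h2
    rw [pow_add, Matrix.mul_apply]
    exact Finset.sum_pos' (fun i _ => mul_nonneg (hpow _ _ _) (hpow _ _ _))
      ⟨z, Finset.mem_univ _, mul_pos h1 h2⟩
  subst hY
  rintro y ⟨x₀, hx₀⟩
  have hS : ∀ n : ℕ, 0 < (P ^ n) y.1 x₀ → 0 < (Pt ^ (n + 1)) y y := by
    intro n hn
    rw [hstep]
    exact Finset.sum_pos' (fun i _ => mul_nonneg (hpow _ _ _) (mul_nonneg (hPnn _ _) (hQnn _ _ _)))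
      ⟨x₀, Finset.mem_univ _, mul_pos hn hx₀⟩
  obtain ⟨k, _, hk⟩ := hirr y.1 x₀
  obtain ⟨r, hr1, hr⟩ := hirr y.1 y.1
  have hle : ∀ d ∈ {d : ℕ | ∀ n ∈ {n : ℕ | 1 ≤ n ∧ 0 < (Pt ^ n) y y}, d ∣ n}, d ≤ 1 := by
    intro d hd
    rw [← hap y.1]
    refine le_csSup ⟨r, fun e he => Nat.le_of_dvd hr1 (he r ⟨hr1, hr⟩)⟩ ?_
    rintro m ⟨_, hm⟩
    have h1 := hd (k + 1) ⟨by omega, hS k hk⟩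
    have h2 := hd (m + k + 1) ⟨by omega, hS (m + k) (hadd _ _ _ _ _ hm hk)⟩
    rw [add_assoc] at h2
    exact (Nat.dvd_add_left h1).1 h2
  have h1 : 1 ∈ {d : ℕ | ∀ n ∈ {n : ℕ | 1 ≤ n ∧ 0 < (Pt ^ n) y y}, d ∣ n} :=
    fun n _ => one_dvd n
  exact le_antisymm (csSup_le ⟨1, h1⟩ hle) (le_csSup ⟨1, hle⟩ h1)
end

section
/- Let X and U be finite nonempty types, P a transition matrix on X, Q : X → X → U → ℝ an output kernel, and ν a stationary distribution for P. Define νY (x,u) := Σ_{x₀} ν x₀ · P x₀ x · Q x₀ x u. Then νY is a probability vector on X × U that is supported on the augmented state space Y (νY (x,u) > 0 implies (x,u) ∈ Y) and is stationary for the augmented transition function P̃: Σ_{(x,u)} νY (x,u) · P̃ (x,u) (x',u') = νY (x',u') for all (x',u'). -/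
/-- If `ν` is a stationary distribution for the transition matrix `P` on `X`, then
`νY (x,u) := ∑ x₀, ν x₀ * P x₀ x * Q x₀ x u` is a probability vector on `X × U`,
supported on the augmented state space `Y := {(x,u) : ∃ x₀, P x₀ x * Q x₀ x u > 0}`,
and stationary for the augmented transition function
`P̃ (x,u) (x',u') := P x x' * Q x x' u'`. -/
theorem stmt_4 {X U : Type*} [Fintype X] [Fintype U] [Nonempty X] [Nonempty U]
    (P : X → X → ℝ) (Q : X → X → U → ℝ)
    (hPnn : ∀ x x' : X, 0 ≤ P x x')
    (hProw : ∀ x : X, ∑ x' : X, P x x' = 1)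
    (hQnn : ∀ (x x' : X) (u : U), 0 ≤ Q x x' u)
    (hQrow : ∀ x x' : X, ∑ u : U, Q x x' u = 1)
    (ν : X → ℝ) (hνnn : ∀ x : X, 0 ≤ ν x) (hνsum : ∑ x : X, ν x = 1)
    (hνstat : ∀ x' : X, ∑ x : X, ν x * P x x' = ν x')
    (Y : Set (X × U)) (hY : Y = {y : X × U | ∃ x₀ : X, 0 < P x₀ y.1 * Q x₀ y.1 y.2})
    (Pt : X × U → X × U → ℝ)
    (hPt : Pt = fun y y' : X × U => P y.1 y'.1 * Q y.1 y'.1 y'.2)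
    (νY : X × U → ℝ)
    (hνY : νY = fun y : X × U => ∑ x₀ : X, ν x₀ * P x₀ y.1 * Q x₀ y.1 y.2) :
    (∀ y : X × U, 0 ≤ νY y) ∧
    (∑ y : X × U, νY y = 1) ∧
    (∀ y : X × U, 0 < νY y → y ∈ Y) ∧
    (∀ y' : X × U, ∑ y : X × U, νY y * Pt y y' = νY y') := by
  have marg : ∀ x : X, ∑ u : U, νY (x, u) = ν x := by
    intro x
    rw [hνY]
    simp only
    rw [Finset.sum_comm, ← hνstat x]
    refine Finset.sum_congr rfl fun x₀ _ => ?_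
    rw [← Finset.mul_sum, hQrow, mul_one]
  refine ⟨?_, ?_, ?_, ?_⟩
  · intro y
    rw [hνY]
    exact Finset.sum_nonneg fun x₀ _ => mul_nonneg (mul_nonneg (hνnn _) (hPnn _ _)) (hQnn _ _ _)
  · rw [Fintype.sum_prod_type, Finset.sum_congr rfl fun x _ => marg x, hνsum]
  · intro y hy
    rw [hνY] at hy
    obtain ⟨x₀, _, h⟩ := Finset.exists_lt_of_sum_lt (s := Finset.univ) (f := fun _ : X => (0 : ℝ))
      (g := fun x₀ => ν x₀ * P x₀ y.1 * Q x₀ y.1 y.2) (by simpa using hy)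
    rw [hY]
    refine ⟨x₀, ?_⟩
    simp only [mul_assoc] at h
    exact pos_of_mul_pos_right h (hνnn x₀)
  · intro y'
    rw [Fintype.sum_prod_type]
    have h2 : νY y' = ∑ x : X, ν x * P x y'.1 * Q x y'.1 y'.2 := by rw [hνY]
    rw [h2, hPt]
    refine Finset.sum_congr rfl fun x _ => ?_
    simp only
    rw [← Finset.sum_mul, marg, mul_assoc]
end

section
/- Let Y be a finite nonempty type, P a transition matrix on Y, and m ≥ 1. Then the snake transition function P_W is a transition matrix on the snake state space W: for every w ∈ W and w' ∈ Y^{m+1}, P_W w w' ≥ 0, any w' with P_W w w' > 0 lies in W, and Σ_{w' ∈ W} P_W w w' = 1. -/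
/-- Given a transition matrix `P` on `Y` and `m ≥ 1`, the snake transition function
`P_W (y₀,…,y_m) (y'₀,…,y'_m) := P y_m y'_m` if `y'_i = y_{i+1}` for `0 ≤ i ≤ m-1`
(and `0` otherwise) is a transition matrix on the snake state space
`W := {(y₀,…,y_m) : ∏_{i=1}^m P y_{i-1} y_i > 0}`: it is nonnegative, any tuple
receiving positive probability lies in `W`, and the total transition probability
into `W` is `1`. -/
theorem stmt_5 {Y : Type*} [Fintype Y] [Nonempty Y] [DecidableEq Y]
    (P : Y → Y → ℝ)
    (hPnn : ∀ y y' : Y, 0 ≤ P y y')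
    (hProw : ∀ y : Y, ∑ y' : Y, P y y' = 1)
    (m : ℕ) (hm : 1 ≤ m)
    (W : Set (Fin (m + 1) → Y))
    (hW : W = {w : Fin (m + 1) → Y | 0 < ∏ i : Fin m, P (w i.castSucc) (w i.succ)})
    (PW : (Fin (m + 1) → Y) → (Fin (m + 1) → Y) → ℝ)
    (hPW : PW = fun w w' : Fin (m + 1) → Y =>
      if ∀ i : Fin m, w' i.castSucc = w i.succ then P (w (Fin.last m)) (w' (Fin.last m))
      else 0) :
    ∀ w ∈ W,
      (∀ w' : Fin (m + 1) → Y, 0 ≤ PW w w') ∧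
      (∀ w' : Fin (m + 1) → Y, 0 < PW w w' → w' ∈ W) ∧
      (∑ w' : Fin (m + 1) → Y, W.indicator (PW w) w' = 1) := by
  subst hW hPW
  intro w hw
  have hpos : ∀ i : Fin m, 0 < P (w i.castSucc) (w i.succ) := by
    intro i
    refine lt_of_le_of_ne (hPnn _ _) (fun h => ?_)
    have hw' : 0 < ∏ i : Fin m, P (w i.castSucc) (w i.succ) := hw
    exact hw'.ne' (Finset.prod_eq_zero (Finset.mem_univ i) h.symm)
  have h1 : ∀ w' : Fin (m + 1) → Y, 0 ≤ (if ∀ i : Fin m, w' i.castSucc = w i.succ then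
      P (w (Fin.last m)) (w' (Fin.last m)) else 0) := by
    intro w'
    split_ifs
    · exact hPnn _ _
    · exact le_rfl
  have h2 : ∀ w' : Fin (m + 1) → Y, 0 < (if ∀ i : Fin m, w' i.castSucc = w i.succ then
      P (w (Fin.last m)) (w' (Fin.last m)) else 0) →
      0 < ∏ i : Fin m, P (w' i.castSucc) (w' i.succ) := by
    intro w' h
    split_ifs at h with hc
    · apply Finset.prod_pos
      intro i _
      obtain ⟨k, rfl⟩ : ∃ k, m = k + 1 := ⟨m - 1, by omega⟩
      rw [hc i]
      induction i using Fin.lastCases with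
      | last => simpa using h
      | cast j =>
        have := hpos j.succ
        rw [Fin.succ_castSucc, hc j.succ]
        exact this
    · exact absurd h (lt_irrefl _)
  refine ⟨h1, h2, ?_⟩
  rw [← hProw (w (Fin.last m))]
  have h3 : ∀ w' : Fin (m + 1) → Y,
      Set.indicator {w : Fin (m + 1) → Y | 0 < ∏ i : Fin m, P (w i.castSucc) (w i.succ)}
      (fun w' => if ∀ i : Fin m, w' i.castSucc = w i.succ then
        P (w (Fin.last m)) (w' (Fin.last m)) else 0) w' =
      (if ∀ i : Fin m, w' i.castSucc = w i.succ then
        P (w (Fin.last m)) (w' (Fin.last m)) else 0) := by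
    intro w'
    rw [Set.indicator_apply_eq_self]
    intro hn
    by_contra hne
    exact hn (h2 w' (lt_of_le_of_ne (h1 w') (Ne.symm hne)))
  refine (Finset.sum_congr rfl (fun w' _ => h3 w')).trans ?_
  rw [← (Fin.snocEquiv (fun _ : Fin (m + 1) => Y)).sum_comp, Fintype.sum_prod_type]
  refine Finset.sum_congr rfl (fun y _ => ?_)
  rw [Finset.sum_eq_single (fun i : Fin m => w i.succ)]
  · simp [Fin.snocEquiv]
  · intro b _ hb
    rw [if_neg]
    intro h
    apply hb
    funext i
    simpa [Fin.snocEquiv] using h i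
  · simp
end

section
/- Let Y be a finite nonempty type, P a transition matrix on Y, and m ≥ 1. If P is irreducible on Y, then the snake transition function P_W is irreducible on the snake state space W, i.e., for all w, w' ∈ W there exists n ≥ 1 with P_W^n w w' > 0. -/
theorem pow_nn_aux {X : Type*} [Fintype X] [DecidableEq X] (A : Matrix X X ℝ)
    (hA : ∀ x y, 0 ≤ A x y) (n : ℕ) : ∀ x y, 0 ≤ (A ^ n) x y := by
  induction n with
  | zero =>
    intro x y
    rw [pow_zero, Matrix.one_apply]
    split_ifs <;> norm_num
  | succ n ih =>
    intro x y
    rw [pow_succ, Matrix.mul_apply]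
    exact Finset.sum_nonneg fun z _ => mul_nonneg (ih x z) (hA z y)

theorem pow_step_aux {X : Type*} [Fintype X] [DecidableEq X] (A : Matrix X X ℝ)
    (hA : ∀ x y, 0 ≤ A x y) (n : ℕ) (x y z : X) (h1 : 0 < (A ^ n) x y) (h2 : 0 < A y z) :
    0 < (A ^ (n + 1)) x z := by
  rw [pow_succ, Matrix.mul_apply]
  exact Finset.sum_pos' (fun t _ => mul_nonneg (pow_nn_aux A hA n x t) (hA t z))
    ⟨y, Finset.mem_univ y, mul_pos h1 h2⟩

/-- If the transition matrix `P` on `Y` is irreducible, then for any `m ≥ 1` the snake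
transition function `P_W` is irreducible on the snake state space
`W := {(y₀,…,y_m) : ∏_{i=1}^m P y_{i-1} y_i > 0}`. -/
theorem stmt_6 {Y : Type*} [Fintype Y] [Nonempty Y] [DecidableEq Y]
    (P : Matrix Y Y ℝ)
    (hPnn : ∀ y y' : Y, 0 ≤ P y y')
    (hProw : ∀ y : Y, ∑ y' : Y, P y y' = 1)
    (hirr : ∀ y y' : Y, ∃ n : ℕ, 1 ≤ n ∧ 0 < (P ^ n) y y')
    (m : ℕ) (hm : 1 ≤ m)
    (W : Set (Fin (m + 1) → Y))
    (hW : W = {w : Fin (m + 1) → Y | 0 < ∏ i : Fin m, P (w i.castSucc) (w i.succ)})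
    (PW : Matrix (Fin (m + 1) → Y) (Fin (m + 1) → Y) ℝ)
    (hPW : PW = Matrix.of fun w w' : Fin (m + 1) → Y =>
      if ∀ i : Fin m, w' i.castSucc = w i.succ then P (w (Fin.last m)) (w' (Fin.last m))
      else 0) :
    ∀ w ∈ W, ∀ w' ∈ W, ∃ n : ℕ, 1 ≤ n ∧ 0 < (PW ^ n) w w' := by
  have hnn : ∀ u v, 0 ≤ PW u v := by
    intro u v
    rw [hPW, Matrix.of_apply]
    split_ifs
    · exact hPnn _ _
    · exact le_rfl
  have hstep : ∀ (u : Fin (m + 1) → Y) (y : Y), 0 < P (u (Fin.last m)) y →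
      0 < PW u (Fin.snoc (α := fun _ => Y) (fun i : Fin m => u i.succ) y) := by
    intro u y h
    rw [hPW, Matrix.of_apply, if_pos]
    · simpa using h
    · intro i
      simp
  have hB : ∀ (u : Fin (m + 1) → Y) (n : ℕ) (y : Y), 0 < (P ^ n) (u (Fin.last m)) y →
      ∃ v : Fin (m + 1) → Y, v (Fin.last m) = y ∧ 0 < (PW ^ n) u v := by
    intro u n
    induction n with
    | zero =>
      intro y h
      rw [pow_zero, Matrix.one_apply] at h
      split_ifs at h with h'
      · exact ⟨u, h', by simp⟩
      · exact absurd h (lt_irrefl _)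
    | succ n ih =>
      intro y h
      rw [pow_succ, Matrix.mul_apply] at h
      obtain ⟨z, -, hz⟩ := Finset.exists_ne_zero_of_sum_ne_zero h.ne'
      have h1 : 0 < (P ^ n) (u (Fin.last m)) z :=
        lt_of_le_of_ne (pow_nn_aux P hPnn n _ _) (Ne.symm (left_ne_zero_of_mul hz))
      have h2 : 0 < P z y :=
        lt_of_le_of_ne (hPnn _ _) (Ne.symm (right_ne_zero_of_mul hz))
      obtain ⟨v, hv, hv'⟩ := ih z h1
      refine ⟨_, ?_, pow_step_aux PW hnn n u v _ hv' (hstep v y (by rw [hv]; exact h2))⟩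
      simp
  intro w hw w' hw'
  rw [hW, Set.mem_ofPred_eq] at hw'
  have hpos : ∀ i : Fin m, 0 < P (w' i.castSucc) (w' i.succ) := fun i =>
    lt_of_le_of_ne (hPnn _ _)
      (Ne.symm (Finset.prod_ne_zero_iff.mp hw'.ne' i (Finset.mem_univ i)))
  obtain ⟨k, hk, hkp⟩ := hirr (w (Fin.last m)) (w' 0)
  obtain ⟨v0, hv0, hv0p⟩ := hB w k _ hkp
  have hC : ∀ j : ℕ, j ≤ m → ∃ v : Fin (m + 1) → Y, 0 < (PW ^ (k + j)) w v ∧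
      ∀ a b : Fin (m + 1), (a : ℕ) + j = m + b → v a = w' b := by
    intro j
    induction j with
    | zero =>
      intro _
      refine ⟨v0, hv0p, ?_⟩
      intro a b hab
      have ha : a = Fin.last m := by ext; simp; omega
      have hb : b = 0 := by ext; rw [Fin.val_zero]; omega
      rw [ha, hb, hv0]
    | succ j ih =>
      intro hj
      obtain ⟨v, hvp, hv⟩ := ih (by omega)
      have hl : v (Fin.last m) = w' (Fin.castSucc ⟨j, hj⟩) := hv _ _ (by simp)
      refine ⟨_, pow_step_aux PW hnn (k + j) w v _ hvp
        (hstep v (w' (Fin.succ ⟨j, hj⟩)) (by rw [hl]; exact hpos _)), ?_⟩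
      intro a b hab
      induction a using Fin.lastCases with
      | last =>
        rw [Fin.snoc_last]
        congr 1
        ext
        simp at hab ⊢
        omega
      | cast i =>
        rw [Fin.snoc_castSucc]
        apply hv
        simp at hab ⊢
        omega
  obtain ⟨v, hvp, hv⟩ := hC m le_rfl
  have hvw : v = w' := by
    funext a
    exact hv a a (by omega)
  exact ⟨k + m, by omega, hvw ▸ hvp⟩
end

section
/- Let Y be a finite nonempty type, P a transition matrix on Y, and m ≥ 1. If P is irreducible and aperiodic on Y, then the snake transition function P_W is aperiodic on the snake state space W, i.e., for every w ∈ W, gcd{n ≥ 1 : P_W^n w w > 0} = 1. -/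
lemma pow_nn {Z : Type*} [Fintype Z] [DecidableEq Z] (Q : Matrix Z Z ℝ)
    (h : ∀ a b, 0 ≤ Q a b) (n : ℕ) : ∀ a b, 0 ≤ (Q ^ n) a b := by
  induction n with
  | zero =>
    intro a b
    rw [pow_zero, Matrix.one_apply]
    split_ifs <;> norm_num
  | succ k ih =>
    intro a b
    rw [pow_succ, Matrix.mul_apply]
    exact Finset.sum_nonneg fun c _ => mul_nonneg (ih a c) (h c b)

lemma mul_pos_entry {Z : Type*} [Fintype Z] (A B : Matrix Z Z ℝ)
    (hA : ∀ a b, 0 ≤ A a b) (hB : ∀ a b, 0 ≤ B a b) (a b c : Z)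
    (h1 : 0 < A a b) (h2 : 0 < B b c) : 0 < (A * B) a c := by
  rw [Matrix.mul_apply]
  exact Finset.sum_pos' (fun c' _ => mul_nonneg (hA _ _) (hB _ _))
    ⟨b, Finset.mem_univ _, mul_pos h1 h2⟩

lemma exists_walk {Z : Type*} [Fintype Z] [DecidableEq Z] (Q : Matrix Z Z ℝ)
    (h : ∀ a b, 0 ≤ Q a b) (n : ℕ) : ∀ a b, 0 < (Q ^ n) a b →
    ∃ f : ℕ → Z, f 0 = a ∧ f n = b ∧ ∀ i < n, 0 < Q (f i) (f (i + 1)) := by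
  induction n with
  | zero =>
    intro a b hab
    rw [pow_zero, Matrix.one_apply] at hab
    split_ifs at hab with e
    · exact ⟨fun _ => a, rfl, e, by simp⟩
    · exact absurd hab (lt_irrefl _)
  | succ k ih =>
    intro a b hab
    rw [pow_succ, Matrix.mul_apply] at hab
    obtain ⟨c, -, hc⟩ := Finset.exists_lt_of_sum_lt (f := fun _ => (0:ℝ)) (by simpa using hab)
    have h1 : 0 < (Q ^ k) a c :=
      lt_of_le_of_ne (pow_nn Q h k a c) (fun e => by simp [← e] at hc)
    have h2 : 0 < Q c b :=
      lt_of_le_of_ne (h c b) (fun e => by simp [← e] at hc)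
    obtain ⟨f, f0, fk, hf⟩ := ih a c h1
    refine ⟨fun i => if i ≤ k then f i else b, by simp [f0], by simp, ?_⟩
    intro i hi
    by_cases e : i = k
    · subst e
      simpa [fk] using h2
    · have : i < k := by omega
      have h3 : i + 1 ≤ k := this
      simpa [this.le, h3] using hf i this

lemma snake_pow {Y : Type*} [Fintype Y] [DecidableEq Y] (P : Matrix Y Y ℝ)
    (m : ℕ) (PW : Matrix (Fin (m + 1) → Y) (Fin (m + 1) → Y) ℝ)
    (hnn : ∀ a b, 0 ≤ PW a b)
    (hPW : PW = Matrix.of fun w w' : Fin (m + 1) → Y =>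
      if ∀ i : Fin m, w' i.castSucc = w i.succ then P (w (Fin.last m)) (w' (Fin.last m))
      else 0) (g : ℕ → Y) (N : ℕ) :
    (∀ i < N, 0 < P (g (i + m)) (g (i + 1 + m))) →
      0 < (PW ^ N) (fun j => g j) (fun j => g (N + j)) := by
  induction N with
  | zero => intro _; simp
  | succ k ih =>
    intro hg
    rw [pow_succ]
    refine mul_pos_entry _ _ (pow_nn PW hnn k) hnn _ _ _ (ih fun i hi => hg i (by omega)) ?_
    rw [hPW, Matrix.of_apply, if_pos]
    · simpa using hg k (by omega)
    · intro i
      simp only [Fin.val_castSucc, Fin.val_succ]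
      congr 1
      omega

lemma snake_return {Y : Type*} [Fintype Y] [DecidableEq Y] (P : Matrix Y Y ℝ)
    (hPnn : ∀ y y' : Y, 0 ≤ P y y')
    (m : ℕ) (PW : Matrix (Fin (m + 1) → Y) (Fin (m + 1) → Y) ℝ)
    (hnn : ∀ a b, 0 ≤ PW a b)
    (hPW : PW = Matrix.of fun w w' : Fin (m + 1) → Y =>
      if ∀ i : Fin m, w' i.castSucc = w i.succ then P (w (Fin.last m)) (w' (Fin.last m))
      else 0) (w : Fin (m + 1) → Y)
    (hw : ∀ i : Fin m, 0 < P (w i.castSucc) (w i.succ)) (k : ℕ)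
    (hk : 0 < (P ^ k) (w (Fin.last m)) (w 0)) :
    0 < (PW ^ (k + m)) w w := by
  obtain ⟨f, f0, fk, hf⟩ := exists_walk P hPnn k _ _ hk
  set v : ℕ → Y := fun i => if h : i < m + 1 then w ⟨i, h⟩ else w 0 with hv
  have hvw : ∀ j : Fin (m + 1), v j = w j := fun j => by
    have := j.isLt
    simp only [hv, this, dif_pos]
  have v0 : v 0 = w 0 := hvw 0
  have vm : v m = w (Fin.last m) := hvw (Fin.last m)
  have hve : ∀ i < m, 0 < P (v i) (v (i + 1)) := fun i hi => by
    have := hw ⟨i, hi⟩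
    rw [← hvw, ← hvw] at this
    simpa using this
  set g : ℕ → Y := fun i => if i < m then v i else if i < m + k then f (i - m) else v (i - (m + k))
    with hgdef
  have g1 : ∀ i ≤ k, g (i + m) = f i := fun i hi => by
    rcases hi.lt_or_eq with h | h
    · have h1 : i + m < m + k := by omega
      simp [hgdef, h1]
    · subst h
      simp [hgdef, add_comm i m, v0, fk]
  have g2 : ∀ i, g (k + m + i) = v i := fun i => by
    have h0 : ¬ (k + m + i < m) := by omega
    have h1 : ¬ (k + m + i < m + k) := by omega
    have h2 : k + m + i - (m + k) = i := by omega
    simp only [hgdef, h0, h1, h2, if_false]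
  have g3 : ∀ i ≤ m, g i = v i := fun i hi => by
    rcases hi.lt_or_eq with h | h
    · simp [hgdef, h]
    · subst h
      have := g1 0 (by omega)
      rw [zero_add] at this
      rw [this, f0, vm]
  have key := snake_pow P m PW hnn hPW g (k + m) (by
    intro i hi
    by_cases h : i < k
    · rw [g1 i h.le, g1 (i + 1) h]
      exact hf i h
    · have e1 : i + m = k + m + (i - k) := by omega
      have e2 : i + 1 + m = k + m + (i - k + 1) := by omega
      rw [e1, e2, g2, g2]
      exact hve _ (by omega))
  have e1 : (fun j : Fin (m + 1) => g j) = w := by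
    funext j
    rw [g3 j (by omega), hvw]
  have e2 : (fun j : Fin (m + 1) => g (k + m + j)) = w := by
    funext j
    rw [g2, hvw]
  rwa [e1, e2] at key

/-- If the transition matrix `P` on `Y` is irreducible and aperiodic, then for any
`m ≥ 1` the snake transition function `P_W` is aperiodic on the snake state space
`W := {(y₀,…,y_m) : ∏_{i=1}^m P y_{i-1} y_i > 0}`. -/
theorem stmt_7 {Y : Type*} [Fintype Y] [Nonempty Y] [DecidableEq Y]
    (P : Matrix Y Y ℝ)
    (hPnn : ∀ y y' : Y, 0 ≤ P y y')
    (hProw : ∀ y : Y, ∑ y' : Y, P y y' = 1)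
    (hirr : ∀ y y' : Y, ∃ n : ℕ, 1 ≤ n ∧ 0 < (P ^ n) y y')
    (hap : ∀ y : Y, setGcd {n : ℕ | 1 ≤ n ∧ 0 < (P ^ n) y y} = 1)
    (m : ℕ) (hm : 1 ≤ m)
    (W : Set (Fin (m + 1) → Y))
    (hW : W = {w : Fin (m + 1) → Y | 0 < ∏ i : Fin m, P (w i.castSucc) (w i.succ)})
    (PW : Matrix (Fin (m + 1) → Y) (Fin (m + 1) → Y) ℝ)
    (hPW : PW = Matrix.of fun w w' : Fin (m + 1) → Y =>
      if ∀ i : Fin m, w' i.castSucc = w i.succ then P (w (Fin.last m)) (w' (Fin.last m))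
      else 0) :
    ∀ w ∈ W, setGcd {n : ℕ | 1 ≤ n ∧ 0 < (PW ^ n) w w} = 1 := by
  intro w hw
  have hnn : ∀ a b, 0 ≤ PW a b := by
    intro a b
    rw [hPW, Matrix.of_apply]
    split_ifs
    · exact hPnn _ _
    · exact le_rfl
  rw [hW, Set.mem_ofPred_eq] at hw
  have hw' : ∀ i : Fin m, 0 < P (w i.castSucc) (w i.succ) := fun i =>
    lt_of_le_of_ne (hPnn _ _) fun e => hw.ne' (Finset.prod_eq_zero (Finset.mem_univ i) e.symm)
  obtain ⟨k, hk1, hk⟩ := hirr (w (Fin.last m)) (w 0)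
  have hret := snake_return P hPnn m PW hnn hPW w hw'
  have hub : ∀ d ∈ {d : ℕ | ∀ n ∈ {n : ℕ | 1 ≤ n ∧ 0 < (PW ^ n) w w}, d ∣ n}, d ≤ 1 := by
    intro d hd
    rw [← hap (w (Fin.last m))]
    obtain ⟨r, hr1, hr⟩ := hirr (w (Fin.last m)) (w (Fin.last m))
    refine le_csSup ⟨r, fun e he => Nat.le_of_dvd hr1 (he r ⟨hr1, hr⟩)⟩ ?_
    rintro n ⟨hn1, hn⟩
    have d1 : d ∣ k + m := hd _ ⟨by omega, hret k hk⟩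
    have d2 : d ∣ n + k + m := hd _ ⟨by omega, hret (n + k) (by
      rw [pow_add]
      exact mul_pos_entry _ _ (pow_nn P hPnn n) (pow_nn P hPnn k) _ _ _ hn hk)⟩
    rw [add_assoc] at d2
    exact (Nat.dvd_add_left d1).mp d2
  refine le_antisymm (csSup_le' hub) (le_csSup ⟨1, hub⟩ ?_)
  intro n _
  exact one_dvd n
end

section
/- Let Y be a finite nonempty type, P a transition matrix on Y, m ≥ 1, and ν a stationary distribution for P. Define ν_W (y₀,…,y_m) := ν y₀ · ∏_{i=1}^m P y_{i-1} y_i. Then ν_W is a probability vector on Y^{m+1} that is supported on the snake state space W (ν_W w > 0 implies w ∈ W) and is stationary for the snake transition function P_W: Σ_w ν_W w · P_W w w' = ν_W w' for all w'. -/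
theorem snake_sum_aux {Y : Type*} [Fintype Y] (P : Y → Y → ℝ)
    (hProw : ∀ y : Y, ∑ y' : Y, P y y' = 1) (m : ℕ) :
    ∀ f : Y → ℝ, ∑ w : Fin (m + 1) → Y,
      f (w 0) * ∏ i : Fin m, P (w i.castSucc) (w i.succ) = ∑ y, f y := by
  induction m with
  | zero =>
    intro f
    rw [← (Equiv.funUnique (Fin 1) Y).sum_comp]
    simp
  | succ k ih =>
    intro f
    rw [← (Fin.consEquiv (fun _ : Fin (k + 1 + 1) => Y)).sum_comp, Fintype.sum_prod_type]
    refine Finset.sum_congr rfl fun y _ => ?_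
    have h := ih (fun z => f y * P y z)
    rw [← Finset.mul_sum, hProw, mul_one] at h
    rw [← h]
    refine Finset.sum_congr rfl fun w _ => ?_
    rw [Fin.prod_univ_succ]
    simp only [Fin.consEquiv_apply, Fin.cons_zero, Fin.castSucc_zero, Fin.cons_succ,
      ← Fin.succ_castSucc]
    ring

/-- If `ν` is a stationary distribution for the transition matrix `P` on `Y` and `m ≥ 1`,
then `ν_W (y₀,…,y_m) := ν y₀ * ∏_{i=1}^m P y_{i-1} y_i` is a probability vector on
`Y^{m+1}`, supported on the snake state space
`W := {(y₀,…,y_m) : ∏_{i=1}^m P y_{i-1} y_i > 0}`, and stationary for the snake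
transition function `P_W`. -/
theorem stmt_8 {Y : Type*} [Fintype Y] [Nonempty Y] [DecidableEq Y]
    (P : Y → Y → ℝ)
    (hPnn : ∀ y y' : Y, 0 ≤ P y y')
    (hProw : ∀ y : Y, ∑ y' : Y, P y y' = 1)
    (m : ℕ) (hm : 1 ≤ m)
    (ν : Y → ℝ) (hνnn : ∀ y : Y, 0 ≤ ν y) (hνsum : ∑ y : Y, ν y = 1)
    (hνstat : ∀ y' : Y, ∑ y : Y, ν y * P y y' = ν y')
    (W : Set (Fin (m + 1) → Y))
    (hW : W = {w : Fin (m + 1) → Y | 0 < ∏ i : Fin m, P (w i.castSucc) (w i.succ)})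
    (PW : (Fin (m + 1) → Y) → (Fin (m + 1) → Y) → ℝ)
    (hPW : PW = fun w w' : Fin (m + 1) → Y =>
      if ∀ i : Fin m, w' i.castSucc = w i.succ then P (w (Fin.last m)) (w' (Fin.last m))
      else 0)
    (νW : (Fin (m + 1) → Y) → ℝ)
    (hνW : νW = fun w : Fin (m + 1) → Y =>
      ν (w 0) * ∏ i : Fin m, P (w i.castSucc) (w i.succ)) :
    (∀ w : Fin (m + 1) → Y, 0 ≤ νW w) ∧
    (∑ w : Fin (m + 1) → Y, νW w = 1) ∧
    (∀ w : Fin (m + 1) → Y, 0 < νW w → w ∈ W) ∧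
    (∀ w' : Fin (m + 1) → Y, ∑ w : Fin (m + 1) → Y, νW w * PW w w' = νW w') := by
  subst hW hPW hνW
  refine ⟨fun w => mul_nonneg (hνnn _) (Finset.prod_nonneg fun i _ => hPnn _ _), ?_, ?_, ?_⟩
  · rw [← hνsum]
    exact snake_sum_aux P hProw m ν
  · intro w hw
    exact pos_of_mul_pos_right hw (hνnn _)
  · intro w'
    obtain ⟨k, rfl⟩ : ∃ k, m = k + 1 := ⟨m - 1, by omega⟩
    rw [← (Fin.consEquiv (fun _ : Fin (k + 1 + 1) => Y)).sum_comp, Fintype.sum_prod_type]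
    simp only [Fin.consEquiv_apply, Fin.cons_zero, Fin.cons_succ]
    rw [← hνstat (w' 0), Finset.sum_mul]
    refine Finset.sum_congr rfl fun y _ => ?_
    rw [Finset.sum_eq_single (fun i : Fin (k + 1) => w' i.castSucc)]
    · rw [if_pos (fun _ => rfl), Fin.prod_univ_succ, Fin.prod_univ_castSucc, ← Fin.succ_last]
      simp only [Fin.cons_zero, Fin.castSucc_zero, Fin.cons_succ, ← Fin.succ_castSucc]
      ring
    · intro u _ hu
      rw [if_neg (fun h => hu (funext fun i => (h i).symm)), mul_zero]
    · simp
end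

section
/- Let Y be a finite nonempty type, P an irreducible transition matrix on Y, m ≥ 1, and ν a stationary distribution for P. Then the snake chain has a unique stationary distribution: if μ is any probability vector on Y^{m+1} supported on the snake state space W and stationary for the snake transition function P_W, then μ (y₀,…,y_m) = ν y₀ · ∏_{i=1}^m P y_{i-1} y_i for all (y₀,…,y_m) ∈ Y^{m+1}. -/
theorem aux_zero {Y : Type*} [Fintype Y] [DecidableEq Y]
    (P : Matrix Y Y ℝ) (hPnn : ∀ y y' : Y, 0 ≤ P y y')
    (hirr : ∀ y y' : Y, ∃ n : ℕ, 1 ≤ n ∧ 0 < (P ^ n) y y')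
    (ρ : Y → ℝ) (h0 : ∀ y, 0 ≤ ρ y) (hs : ∀ y' : Y, ∑ y : Y, ρ y * P y y' = ρ y')
    (y0 : Y) (hy0 : ρ y0 = 0) (y : Y) : ρ y = 0 := by
  have hn : ∀ n : ℕ, Matrix.vecMul ρ (P ^ n) = ρ := by
    intro n
    induction n with
    | zero => simp
    | succ k ih =>
      rw [pow_succ, ← Matrix.vecMul_vecMul, ih]
      funext y'
      exact hs y'
  have hp : ∀ n : ℕ, ∀ a b, 0 ≤ (P ^ n) a b := by
    intro n
    induction n with
    | zero => intro a b; rw [pow_zero, Matrix.one_apply]; split_ifs <;> norm_num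
    | succ k ih =>
      intro a b
      rw [pow_succ, Matrix.mul_apply]
      exact Finset.sum_nonneg fun i _ => mul_nonneg (ih _ _) (hPnn _ _)
  obtain ⟨n, -, hpos⟩ := hirr y y0
  have h1 : ∑ z : Y, ρ z * (P ^ n) z y0 = 0 := by
    have := congrFun (hn n) y0
    rw [hy0] at this
    exact this
  have h2 := (Finset.sum_eq_zero_iff_of_nonneg
    (fun z _ => mul_nonneg (h0 z) (hp n z y0))).1 h1 y (Finset.mem_univ y)
  exact (mul_eq_zero.1 h2).resolve_right hpos.ne'

theorem aux_unique {Y : Type*} [Fintype Y] [Nonempty Y] [DecidableEq Y]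
    (P : Matrix Y Y ℝ) (hPnn : ∀ y y' : Y, 0 ≤ P y y')
    (hirr : ∀ y y' : Y, ∃ n : ℕ, 1 ≤ n ∧ 0 < (P ^ n) y y')
    (ν : Y → ℝ) (hνnn : ∀ y : Y, 0 ≤ ν y) (hνsum : ∑ y : Y, ν y = 1)
    (hνstat : ∀ y' : Y, ∑ y : Y, ν y * P y y' = ν y')
    (π : Y → ℝ) (hπsum : ∑ y : Y, π y = 1)
    (hπstat : ∀ y' : Y, ∑ y : Y, π y * P y y' = π y') (y : Y) : π y = ν y := by
  have hpos : ∀ y, 0 < ν y := by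
    intro y
    refine lt_of_le_of_ne (hνnn y) fun h => ?_
    have : ∀ z, ν z = 0 := aux_zero P hPnn hirr ν hνnn hνstat y h.symm
    simp [this] at hνsum
  obtain ⟨y0, hy0⟩ := Finite.exists_min (fun y => π y / ν y)
  set c := π y0 / ν y0 with hc
  have hz : ∀ z, π z - c * ν z = 0 := by
    refine aux_zero P hPnn hirr (fun z => π z - c * ν z) ?_ ?_ y0 ?_
    · intro z
      have := (le_div_iff₀ (hpos z)).1 (hy0 z)
      simpa using this
    · intro y'
      simp only [sub_mul, Finset.sum_sub_distrib, mul_assoc, ← Finset.mul_sum, hπstat, hνstat]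
    · simp only [hc]
      rw [div_mul_cancel₀ _ (hpos y0).ne', sub_self]
  have hz' : ∀ z, π z = c * ν z := fun z => sub_eq_zero.1 (hz z)
  have hc1 : c = 1 := by
    simp only [hz', ← Finset.mul_sum, hνsum] at hπsum
    linarith
  rw [hz', hc1, one_mul]

theorem aux_sum {Y : Type*} [Fintype Y] [DecidableEq Y] (m : ℕ)
    (w' : Fin (m + 1) → Y) (F : (Fin (m + 1) → Y) → ℝ) :
    (∑ w : Fin (m + 1) → Y, if ∀ i : Fin m, w' i.castSucc = w i.succ then F w else 0)
      = ∑ a : Y, F (Fin.cons a (Fin.init w')) := by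
  rw [← (Fin.consEquiv (fun _ : Fin (m + 1) => Y)).sum_comp, Fintype.sum_prod_type]
  refine Finset.sum_congr rfl fun a _ => ?_
  rw [Finset.sum_eq_single (Fin.init w')]
  · simp [Fin.consEquiv, Fin.init]
  · intro b _ hb
    rw [if_neg]
    intro h
    apply hb
    funext i
    simpa [Fin.consEquiv, Fin.init] using (h i).symm
  · simp

theorem aux_main {Y : Type*} [Fintype Y] [Nonempty Y] [DecidableEq Y]
    (P : Matrix Y Y ℝ)
    (hPnn : ∀ y y' : Y, 0 ≤ P y y')
    (hProw : ∀ y : Y, ∑ y' : Y, P y y' = 1)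
    (hirr : ∀ y y' : Y, ∃ n : ℕ, 1 ≤ n ∧ 0 < (P ^ n) y y')
    (ν : Y → ℝ) (hνnn : ∀ y : Y, 0 ≤ ν y) (hνsum : ∑ y : Y, ν y = 1)
    (hνstat : ∀ y' : Y, ∑ y : Y, ν y * P y y' = ν y')
    (m : ℕ) (μ : (Fin (m + 1) → Y) → ℝ)
    (hμsum : ∑ w : Fin (m + 1) → Y, μ w = 1)
    (hμstat : ∀ w' : Fin (m + 1) → Y,
      ∑ a : Y, μ (Fin.cons a (Fin.init w')) *
        P ((Fin.cons a (Fin.init w') : Fin (m + 1) → Y) (Fin.last m)) (w' (Fin.last m)) = μ w') :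
    ∀ w : Fin (m + 1) → Y,
      μ w = ν (w 0) * ∏ i : Fin m, P (w i.castSucc) (w i.succ) := by
  induction m with
  | zero =>
    have key := aux_unique P hPnn hirr ν hνnn hνsum hνstat (fun y => μ (fun _ => y)) ?_ ?_
    · intro w
      have hw : w = fun _ => w 0 := by funext i; rw [show i = 0 from Subsingleton.elim (α := Fin 1) i 0]
      simp only [Finset.univ_eq_empty, Finset.prod_empty, mul_one]
      rw [← key]; exact congrArg μ hw
    · rw [← hμsum, ← (Equiv.funUnique (Fin 1) Y).symm.sum_comp]
      rfl
    · intro y'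
      have := hμstat (fun _ => y')
      rw [← this]
      refine Finset.sum_congr rfl fun a _ => ?_
      have h : (Fin.cons a (Fin.init (fun _ : Fin 1 => y')) : Fin 1 → Y) = fun _ => a := by
        funext i; rw [show i = 0 from Subsingleton.elim (α := Fin 1) i 0]; rfl
      rw [h]
  | succ m ih =>
    have st : ∀ (u : Fin (m + 1) → Y) (b : Y),
        μ (Fin.snoc u b) = (∑ a, μ (Fin.cons a u)) * P (u (Fin.last m)) b := by
      intro u b
      rw [← hμstat, Finset.sum_mul]
      refine Finset.sum_congr rfl fun a _ => ?_
      rw [Fin.init_snoc, Fin.snoc_last, ← Fin.succ_last, Fin.cons_succ]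
    have hg : ∀ u : Fin (m + 1) → Y, ∑ b, μ (Fin.snoc u b) = ∑ a, μ (Fin.cons a u) := by
      intro u
      simp only [st, ← Finset.mul_sum, hProw, mul_one]
    have key := ih (fun u => ∑ a, μ (Fin.cons a u)) ?_ ?_
    · intro w
      have e : w = Fin.snoc (Fin.init w) (w (Fin.last _)) := (Fin.snoc_init_self w).symm
      have h1 : μ w = _ := (congrArg μ e).trans (st _ _)
      rw [h1, key, Fin.prod_univ_castSucc, mul_assoc]
      rfl
    · rw [← hμsum, ← (Fin.consEquiv (fun _ : Fin (m + 2) => Y)).sum_comp,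
        Fintype.sum_prod_type, Finset.sum_comm]
      rfl
    · intro w'
      refine Finset.sum_congr rfl fun a _ => ?_
      rw [← st]
      congr 1
      rw [← Fin.cons_snoc_eq_snoc_cons, Fin.snoc_init_self]

/-- If `P` is an irreducible transition matrix on `Y`, `ν` is a stationary distribution
for `P`, and `m ≥ 1`, then the snake chain has a unique stationary distribution:
any probability vector `μ` on `Y^{m+1}` supported on the snake state space `W` and
stationary for the snake transition function `P_W` satisfies
`μ (y₀,…,y_m) = ν y₀ * ∏_{i=1}^m P y_{i-1} y_i`. -/
theorem stmt_10 {Y : Type*} [Fintype Y] [Nonempty Y] [DecidableEq Y]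
    (P : Matrix Y Y ℝ)
    (hPnn : ∀ y y' : Y, 0 ≤ P y y')
    (hProw : ∀ y : Y, ∑ y' : Y, P y y' = 1)
    (hirr : ∀ y y' : Y, ∃ n : ℕ, 1 ≤ n ∧ 0 < (P ^ n) y y')
    (m : ℕ) (hm : 1 ≤ m)
    (ν : Y → ℝ) (hνnn : ∀ y : Y, 0 ≤ ν y) (hνsum : ∑ y : Y, ν y = 1)
    (hνstat : ∀ y' : Y, ∑ y : Y, ν y * P y y' = ν y')
    (W : Set (Fin (m + 1) → Y))
    (hW : W = {w : Fin (m + 1) → Y | 0 < ∏ i : Fin m, P (w i.castSucc) (w i.succ)})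
    (PW : (Fin (m + 1) → Y) → (Fin (m + 1) → Y) → ℝ)
    (hPW : PW = fun w w' : Fin (m + 1) → Y =>
      if ∀ i : Fin m, w' i.castSucc = w i.succ then P (w (Fin.last m)) (w' (Fin.last m))
      else 0)
    (μ : (Fin (m + 1) → Y) → ℝ)
    (hμnn : ∀ w : Fin (m + 1) → Y, 0 ≤ μ w)
    (hμsum : ∑ w : Fin (m + 1) → Y, μ w = 1)
    (hμsupp : ∀ w : Fin (m + 1) → Y, 0 < μ w → w ∈ W)
    (hμstat : ∀ w' : Fin (m + 1) → Y, ∑ w : Fin (m + 1) → Y, μ w * PW w w' = μ w') :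
    ∀ w : Fin (m + 1) → Y,
      μ w = ν (w 0) * ∏ i : Fin m, P (w i.castSucc) (w i.succ) := by
  refine aux_main P hPnn hProw hirr ν hνnn hνsum hνstat m μ hμsum ?_
  intro w'
  rw [← hμstat w', hPW]
  simp only [mul_ite, mul_zero]
  exact (aux_sum m w' (fun w => μ w * P (w (Fin.last m)) (w' (Fin.last m)))).symm
end

section
/- Let Z, S, A be finite nonempty types, val : Z → ℝ, and fix s ∈ S, a ∈ A. Let νS : Z → ℝ and νZ : Z → ℝ be the true conditional probabilities νS(z) = ν(s | z, a) ∈ [0,1] and νZ(z) = ν(z | a) ∈ [0,1], and assume D := Σ_z νS(z) · νZ(z) > 0. Define Q := Σ_z val(z) · νS(z) · νZ(z) / D. On a probability space, let ρS_n(z) and ρZ_n(z) be sequences of [0,1]-valued random variables such that for every z, ρS_n(z) → νS(z) in probability and ρZ_n(z) → νZ(z) in probability. Define the random variable Q̂_n := Σ_z val(z) · ρS_n(z) · ρZ_n(z) / (Σ_{z'} ρS_n(z') · ρZ_n(z')) whenever the denominator is positive (and Q̂_n := 0 otherwise). Then for every ε > 0, lim_{n→∞} P(|Q̂_n − Q|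 ≥ ε) = 0. -/
open MeasureTheory Filter

/-- The CNC plug-in estimate of the action-value: the Bayes-rule ratio formed from the
estimated conditionals `ρS` and `ρZ` whenever the denominator is positive, `0` otherwise. -/
noncomputable def QhatEst {Z : Type*} [Fintype Z] {Ω : Type*} (val : Z → ℝ)
    (ρS ρZ : ℕ → Z → Ω → ℝ) (n : ℕ) (ω : Ω) : ℝ :=
  if 0 < ∑ z' : Z, ρS n z' ω * ρZ n z' ω then
    (∑ z : Z, val z * ρS n z ω * ρZ n z ω) / (∑ z' : Z, ρS n z' ω * ρZ n z' ω)
  else 0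

/-- Consistency of the CNC plug-in action-value estimate (Theorem 1 of the paper,
consistency part): if the estimators `ρS n z` and `ρZ n z` converge in probability to the
true conditional probabilities `νS z = ν(s | z,a)` and `νZ z = ν(z | a)`, and the true
denominator `D = ∑ z, νS z * νZ z` is positive, then the plug-in estimate `Q̂ₙ` converges
in probability to `Q = ∑ z, val z * νS z * νZ z / D`. -/
theorem stmt_12 {Z S A : Type*} [Fintype Z] [Fintype S] [Fintype A]
    [Nonempty Z] [Nonempty S] [Nonempty A]
    (val : Z → ℝ) (s : S) (a : A)
    {Ω : Type*} [MeasurableSpace Ω] (μ : Measure Ω) [IsProbabilityMeasure μ]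
    (νS νZ : Z → ℝ)
    (hνS : ∀ z : Z, νS z ∈ Set.Icc (0 : ℝ) 1)
    (hνZ : ∀ z : Z, νZ z ∈ Set.Icc (0 : ℝ) 1)
    (hD : 0 < ∑ z : Z, νS z * νZ z)
    (Q : ℝ) (hQ : Q = (∑ z : Z, val z * νS z * νZ z) / (∑ z : Z, νS z * νZ z))
    (ρS ρZ : ℕ → Z → Ω → ℝ)
    (hmS : ∀ (n : ℕ) (z : Z), Measurable (ρS n z))
    (hmZ : ∀ (n : ℕ) (z : Z), Measurable (ρZ n z))
    (h01S : ∀ (n : ℕ) (z : Z) (ω : Ω), ρS n z ω ∈ Set.Icc (0 : ℝ) 1)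
    (h01Z : ∀ (n : ℕ) (z : Z) (ω : Ω), ρZ n z ω ∈ Set.Icc (0 : ℝ) 1)
    (hconvS : ∀ z : Z, ∀ ε : ℝ, 0 < ε →
      Tendsto (fun n : ℕ => μ {ω : Ω | ε ≤ |ρS n z ω - νS z|}) atTop (nhds 0))
    (hconvZ : ∀ z : Z, ∀ ε : ℝ, 0 < ε →
      Tendsto (fun n : ℕ => μ {ω : Ω | ε ≤ |ρZ n z ω - νZ z|}) atTop (nhds 0)) :
    ∀ ε : ℝ, 0 < ε →
      Tendsto (fun n : ℕ => μ {ω : Ω | ε ≤ |QhatEst val ρS ρZ n ω - Q|}) atTop (nhds 0) := by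
  intro ε hε
  let F : (Z → ℝ) × (Z → ℝ) → ℝ := fun p =>
    (∑ z : Z, val z * p.1 z * p.2 z) / (∑ z : Z, p.1 z * p.2 z)
  have hF : ContinuousAt F (νS, νZ) := by
    apply ContinuousAt.div
    · fun_prop
    · fun_prop
    · exact hD.ne'
  have hE : ∀ n ω, QhatEst val ρS ρZ n ω = F (fun z => ρS n z ω, fun z => ρZ n z ω) := by
    intro n ω
    have h0 : 0 ≤ ∑ z : Z, ρS n z ω * ρZ n z ω :=
      Finset.sum_nonneg fun z _ => mul_nonneg (h01S n z ω).1 (h01Z n z ω).1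
    simp only [QhatEst, F]
    split_ifs with h
    · rfl
    · have : ∑ z : Z, ρS n z ω * ρZ n z ω = 0 := le_antisymm (not_lt.1 h) h0
      rw [this, div_zero]
  obtain ⟨δ, hδ, hball⟩ := Metric.continuousAt_iff.1 hF ε hε
  have hlim : Tendsto (fun n : ℕ => ∑ z : Z, (μ {ω : Ω | δ ≤ |ρS n z ω - νS z|}
      + μ {ω : Ω | δ ≤ |ρZ n z ω - νZ z|})) atTop (nhds 0) := by
    have := tendsto_finsetSum (Finset.univ : Finset Z)
      (fun z _ => (hconvS z δ hδ).add (hconvZ z δ hδ))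
    simpa using this
  refine tendsto_of_tendsto_of_tendsto_of_le_of_le tendsto_const_nhds hlim
    (fun _ => zero_le) (fun n => ?_)
  have hsub : {ω : Ω | ε ≤ |QhatEst val ρS ρZ n ω - Q|} ⊆
      ⋃ z ∈ (Finset.univ : Finset Z), ({ω : Ω | δ ≤ |ρS n z ω - νS z|}
        ∪ {ω : Ω | δ ≤ |ρZ n z ω - νZ z|}) := by
    intro ω hω
    by_contra hcon
    simp only [Finset.mem_univ, Set.iUnion_true, Set.mem_iUnion, Set.mem_union,
      Set.mem_setOf_eq, not_exists, not_or, not_le] at hcon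
    have hd : dist ((fun z => ρS n z ω, fun z => ρZ n z ω) : (Z → ℝ) × (Z → ℝ)) (νS, νZ) < δ := by
      rw [Prod.dist_eq]
      exact max_lt ((dist_pi_lt_iff hδ).2 fun z => (hcon z).1)
        ((dist_pi_lt_iff hδ).2 fun z => (hcon z).2)
    have h2 := hball hd
    rw [Real.dist_eq, ← hE] at h2
    have h3 : F (νS, νZ) = Q := hQ.symm
    rw [h3] at h2
    exact absurd hω (not_le.2 h2)
  calc _ ≤ _ := measure_mono hsub
    _ ≤ _ := measure_biUnion_finset_le _ _
    _ ≤ _ := Finset.sum_le_sum fun z _ => measure_union_le _ _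
end

section
/- Let Z, S, A be finite nonempty types, val : Z → ℝ, and fix s ∈ S, a ∈ A. Let νS : Z → ℝ and νZ : Z → ℝ be the true conditional probabilities νS(z) = ν(s | z, a) ∈ [0,1] and νZ(z) = ν(z | a) ∈ [0,1], and assume D := Σ_z νS(z) · νZ(z) > 0. Define Q := Σ_z val(z) · νS(z) · νZ(z) / D. On a probability space, let ρS_n(z) and ρZ_n(z) be sequences of [0,1]-valued random variables such that for every z, |ρS_n(z) − νS(z)| ∈ O_P(n^{-1/2}) and |ρZ_n(z) − νZ(z)| ∈ O_P(n^{-1/2}). Define Q̂_n := Σ_z val(z) · ρS_n(z) · ρZ_n(z) / (Σ_{z'} ρS_n(z') · ρZ_n(z')) whenever the denominator is positive (and Q̂_n := 0 otherwise). Then |Q̂_n − Q| ∈ O_P(n^{-1/2}). -/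
open MeasureTheory

/-- `f` converges stochastically to `0` with rate `n^{-1/2}`, written `f_n ∈ O_P(n^{-1/2})`:
there is `c > 0` such that for all `δ ∈ (0,1]` and all `n ≥ 1`,
`P(|f n| ≤ √((c/n)·ln(2/δ))) ≥ 1 − δ`. -/
def OPsqrt {Ω : Type*} [MeasurableSpace Ω] (μ : Measure Ω) (f : ℕ → Ω → ℝ) : Prop :=
  ∃ c : ℝ, 0 < c ∧ ∀ δ : ℝ, 0 < δ → δ ≤ 1 → ∀ n : ℕ, 1 ≤ n →
    ENNReal.ofReal (1 - δ) ≤ μ {ω : Ω | |f n ω| ≤ Real.sqrt (c / n * Real.log (2 / δ))}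

theorem OPsqrt_of_bound {ι Ω : Type*} [Fintype ι] [Nonempty ι] [MeasurableSpace Ω]
    (μ : Measure Ω) [IsProbabilityMeasure μ] (g : ι → ℕ → Ω → ℝ)
    (hm : ∀ i n, Measurable (g i n)) (h : ∀ i, OPsqrt μ (g i)) (K : ℝ) (hK : 0 < K)
    (f : ℕ → Ω → ℝ) (hf : ∀ n ω, |f n ω| ≤ K * ∑ i, |g i n ω|) : OPsqrt μ f := by
  choose c hc h using h
  set m : ℝ := (Fintype.card ι : ℝ) with hmdef
  have hm1 : 1 ≤ m := by
    rw [hmdef]; exact_mod_cast Fintype.card_pos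
  have hm0 : 0 < m := by linarith
  set C : ℝ := ∑ i, c i with hC
  have hC0 : 0 < C := Finset.sum_pos (fun i _ => hc i) Finset.univ_nonempty
  have hcC : ∀ i, c i ≤ C := fun i =>
    Finset.single_le_sum (fun j _ => (hc j).le) (Finset.mem_univ i)
  have hl2 : 0 < Real.log 2 := Real.log_pos (by norm_num)
  have hlm : 0 ≤ Real.log m := Real.log_nonneg hm1
  set L : ℝ := 1 + Real.log m / Real.log 2 with hL
  have hL0 : 0 < L := by positivity
  refine ⟨(K * m) ^ 2 * (C * L), by positivity, ?_⟩
  intro δ hδ hδ1 n hn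
  have hn0 : (0 : ℝ) < n := by exact_mod_cast hn
  have hδm : 0 < δ / m := by positivity
  have hδm1 : δ / m ≤ 1 := by rw [div_le_one hm0]; linarith
  have hlogδ : Real.log 2 ≤ Real.log (2 / δ) := by
    apply Real.log_le_log (by norm_num)
    rw [le_div_iff₀ hδ]; linarith
  have hlog : Real.log (2 / (δ / m)) ≤ L * Real.log (2 / δ) := by
    have e : 2 / (δ / m) = m * (2 / δ) := by field_simp
    rw [e, Real.log_mul hm0.ne' (by positivity), hL]
    have : Real.log m / Real.log 2 * Real.log 2 ≤ Real.log m / Real.log 2 * Real.log (2 / δ) := by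
      gcongr
    rw [div_mul_cancel₀ _ hl2.ne'] at this
    linarith
  have hlog0 : 0 ≤ Real.log (2 / (δ / m)) := by
    apply Real.log_nonneg
    rw [le_div_iff₀ hδm]; linarith
  set G : ι → Set Ω := fun i =>
    {ω | |g i n ω| ≤ Real.sqrt (c i / n * Real.log (2 / (δ / m)))} with hG
  have hGm : ∀ i, MeasurableSet (G i) := fun i =>
    measurableSet_le ((hm i n).abs) measurable_const
  have hGc : ∀ i, μ.real (G i)ᶜ ≤ δ / m := by
    intro i
    have h1 := h i (δ / m) hδm hδm1 n hn
    rw [ENNReal.ofReal_le_iff_le_toReal (measure_ne_top _ _)] at h1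
    rw [probReal_compl_eq_one_sub (hGm i)]
    change 1 - δ / m ≤ μ.real (G i) at h1
    linarith
  have hU : μ.real (⋂ i, G i)ᶜ ≤ δ := by
    rw [Set.compl_iInter]
    calc μ.real (⋃ i, (G i)ᶜ) ≤ ∑ i, μ.real (G i)ᶜ := measureReal_iUnion_fintype_le _
      _ ≤ ∑ _i : ι, δ / m := Finset.sum_le_sum (fun i _ => hGc i)
      _ = δ := by
        rw [Finset.sum_const, Finset.card_univ, nsmul_eq_mul, ← hmdef]; field_simp
  rw [probReal_compl_eq_one_sub (MeasurableSet.iInter hGm)] at hU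
  have hI : ENNReal.ofReal (1 - δ) ≤ μ (⋂ i, G i) := by
    rw [ENNReal.ofReal_le_iff_le_toReal (measure_ne_top _ _)]
    change 1 - δ ≤ μ.real (⋂ i, G i)
    linarith
  refine hI.trans (measure_mono ?_)
  intro ω hω
  rw [Set.mem_iInter] at hω
  change |f n ω| ≤ _
  have e2 : (K * m) ^ 2 * (C * L) / n * Real.log (2 / δ)
      = (K * m) ^ 2 * (C / n * (L * Real.log (2 / δ))) := by ring
  rw [e2, Real.sqrt_mul (by positivity), Real.sqrt_sq (by positivity)]
  calc |f n ω| ≤ K * ∑ i, |g i n ω| := hf n ω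
    _ ≤ K * ∑ _i : ι, Real.sqrt (C / n * (L * Real.log (2 / δ))) := by
      gcongr with i
      refine (hω i).trans ?_
      apply Real.sqrt_le_sqrt
      have := hcC i
      gcongr
    _ = _ := by
      rw [Finset.sum_const, Finset.card_univ, nsmul_eq_mul, ← hmdef]; ring

theorem ratio_bound {Z : Type*} [Fintype Z] (val p q : Z → ℝ) (hp : ∀ z, 0 ≤ p z)
    (hD : 0 < ∑ z, q z) (Qh : ℝ)
    (hQh : Qh = if 0 < ∑ z, p z then (∑ z, val z * p z) / ∑ z, p z else 0) :
    |Qh - (∑ z, val z * q z) / ∑ z, q z| ≤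
      (2 * (∑ z, |val z|) / ∑ z, q z) * ∑ z, |p z - q z| := by
  set V := ∑ z, |val z| with hV
  have hV0 : 0 ≤ V := Finset.sum_nonneg (fun _ _ => abs_nonneg _)
  have hvV : ∀ z, |val z| ≤ V := fun z =>
    Finset.single_le_sum (f := fun z => |val z|) (fun j _ => abs_nonneg _) (Finset.mem_univ z)
  have key : Qh * ∑ z, p z = ∑ z, val z * p z ∧ |Qh| ≤ V := by
    split_ifs at hQh with hpos
    · constructor
      · rw [hQh]; field_simp
      · rw [hQh, abs_div, abs_of_pos hpos, div_le_iff₀ hpos, Finset.mul_sum]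
        refine (Finset.abs_sum_le_sum_abs _ _).trans (Finset.sum_le_sum fun z _ => ?_)
        rw [abs_mul, abs_of_nonneg (hp z)]
        exact mul_le_mul_of_nonneg_right (hvV z) (hp z)
    · have h0 : ∑ z, p z = 0 := le_antisymm (not_lt.mp hpos) (Finset.sum_nonneg fun z _ => hp z)
      have hz := (Finset.sum_eq_zero_iff_of_nonneg (fun z _ => hp z)).mp h0
      constructor
      · rw [hQh, zero_mul, Finset.sum_eq_zero]
        intro z hzz
        rw [hz z hzz, mul_zero]
      · rw [hQh, abs_zero]; exact hV0
  obtain ⟨k1, k2⟩ := key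
  set D := ∑ z, q z with hDd
  have e : Qh - (∑ z, val z * q z) / D = (∑ z, (val z - Qh) * (p z - q z)) / D := by
    have : ∑ z, (val z - Qh) * (p z - q z)
        = (∑ z, val z * p z) - (∑ z, val z * q z) - Qh * (∑ z, p z) + Qh * D := by
      rw [hDd, Finset.mul_sum, Finset.mul_sum, ← Finset.sum_sub_distrib, ← Finset.sum_sub_distrib,
        ← Finset.sum_add_distrib]
      exact Finset.sum_congr rfl fun z _ => by ring
    rw [this, k1]; field_simp; ring
  rw [e, abs_div, abs_of_pos hD, div_mul_eq_mul_div]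
  gcongr
  rw [Finset.mul_sum]
  refine (Finset.abs_sum_le_sum_abs _ _).trans (Finset.sum_le_sum fun z _ => ?_)
  rw [abs_mul]
  gcongr
  have := abs_sub (val z) Qh
  linarith [hvV z]

/-- Convergence rate of the CNC plug-in action-value estimate (Theorem 1 of the paper,
rate part): if `|ρS n z − νS z| ∈ O_P(n^{-1/2})` and `|ρZ n z − νZ z| ∈ O_P(n^{-1/2})` for
every `z`, and the true denominator `D = ∑ z, νS z * νZ z` is positive, then
`|Q̂ₙ − Q| ∈ O_P(n^{-1/2})`. -/
theorem stmt_13 {Z S A : Type*} [Fintype Z] [Fintype S] [Fintype A]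
    [Nonempty Z] [Nonempty S] [Nonempty A]
    (val : Z → ℝ) (s : S) (a : A)
    {Ω : Type*} [MeasurableSpace Ω] (μ : Measure Ω) [IsProbabilityMeasure μ]
    (νS νZ : Z → ℝ)
    (hνS : ∀ z : Z, νS z ∈ Set.Icc (0 : ℝ) 1)
    (hνZ : ∀ z : Z, νZ z ∈ Set.Icc (0 : ℝ) 1)
    (hD : 0 < ∑ z : Z, νS z * νZ z)
    (Q : ℝ) (hQ : Q = (∑ z : Z, val z * νS z * νZ z) / (∑ z : Z, νS z * νZ z))
    (ρS ρZ : ℕ → Z → Ω → ℝ)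
    (hmS : ∀ (n : ℕ) (z : Z), Measurable (ρS n z))
    (hmZ : ∀ (n : ℕ) (z : Z), Measurable (ρZ n z))
    (h01S : ∀ (n : ℕ) (z : Z) (ω : Ω), ρS n z ω ∈ Set.Icc (0 : ℝ) 1)
    (h01Z : ∀ (n : ℕ) (z : Z) (ω : Ω), ρZ n z ω ∈ Set.Icc (0 : ℝ) 1)
    (hrateS : ∀ z : Z, OPsqrt μ (fun n ω => ρS n z ω - νS z))
    (hrateZ : ∀ z : Z, OPsqrt μ (fun n ω => ρZ n z ω - νZ z)) :
    OPsqrt μ (fun n ω => QhatEst val ρS ρZ n ω - Q) := by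
  classical
  set D := ∑ z, νS z * νZ z with hDd
  have hV0 : 0 ≤ ∑ z, |val z| := Finset.sum_nonneg (fun _ _ => abs_nonneg _)
  refine OPsqrt_of_bound μ (ι := Z ⊕ Z)
    (Sum.elim (fun z n ω => ρS n z ω - νS z) (fun z n ω => ρZ n z ω - νZ z))
    ?_ ?_ (2 * (∑ z, |val z|) / D + 1) (by positivity) _ ?_
  · rintro (z | z) n
    · exact (hmS n z).sub_const _
    · exact (hmZ n z).sub_const _
  · rintro (z | z)
    · exact hrateS z
    · exact hrateZ z
  · intro n ω
    have hb := ratio_bound val (fun z => ρS n z ω * ρZ n z ω) (fun z => νS z * νZ z)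
      (fun z => mul_nonneg (h01S n z ω).1 (h01Z n z ω).1) hD (QhatEst val ρS ρZ n ω)
      (by simp only [QhatEst, mul_assoc])
    have hQ' : Q = (∑ z, val z * (νS z * νZ z)) / ∑ z, νS z * νZ z := by
      rw [hQ]; simp only [mul_assoc, hDd]
    rw [← hQ'] at hb
    refine hb.trans ?_
    rw [Fintype.sum_sum_type]
    simp only [Sum.elim_inl, Sum.elim_inr]
    rw [← Finset.sum_add_distrib]
    refine mul_le_mul (by linarith) (Finset.sum_le_sum fun z _ => ?_)
      (Finset.sum_nonneg fun _ _ => abs_nonneg _) (by positivity)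
    have e : ρS n z ω * ρZ n z ω - νS z * νZ z
        = (ρS n z ω - νS z) * ρZ n z ω + νS z * (ρZ n z ω - νZ z) := by ring
    rw [e]
    refine (abs_add_le _ _).trans ?_
    rw [abs_mul, abs_mul, abs_of_nonneg (h01Z n z ω).1, abs_of_nonneg (hνS z).1]
    exact add_le_add (mul_le_of_le_one_right (abs_nonneg _) (h01Z n z ω).2)
      (mul_le_of_le_one_left (abs_nonneg _) (hνS z).2)
end

section
/- Let Z be a finite nonempty type, val : Z → ℝ with |val(z)| ≤ M for all z, and let p, q, p̂, q̂ : Z → [0,1] with D := Σ_z p(z) · q(z) > 0. Let k := |Z| and suppose ε ≥ 0 satisfies max_z |p̂(z) − p(z)| ≤ ε, max_z |q̂(z) − q(z)| ≤ ε, and ε ≤ D / (4k). Then Σ_z p̂(z) · q̂(z) ≥ D/2 and |Σ_z val(z) · p̂(z) · q̂(z) / (Σ_{z'} p̂(z') · q̂(z')) − Σ_z val(z) · p(z) · q(z) / D| ≤ (4·M·k/D)·(1 + k/D)·ε. -/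
/-- Deterministic perturbation bound for the Bayes plug-in ratio: if `p̂, q̂` are
entrywise `ε`-accurate approximations of `p, q : Z → [0,1]`, the true denominator
`D = ∑ z, p z * q z` is positive, `|val| ≤ M`, `k = |Z|`, and `ε ≤ D/(4k)`, then the
perturbed denominator is at least `D/2` and the plug-in ratio is within
`(4Mk/D)(1 + k/D)ε` of the true ratio. -/
theorem stmt_14 {Z : Type*} [Fintype Z] [Nonempty Z]
    (val : Z → ℝ) (M : ℝ) (hval : ∀ z : Z, |val z| ≤ M)
    (p q phat qhat : Z → ℝ)
    (hp : ∀ z : Z, p z ∈ Set.Icc (0 : ℝ) 1)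
    (hq : ∀ z : Z, q z ∈ Set.Icc (0 : ℝ) 1)
    (hphat : ∀ z : Z, phat z ∈ Set.Icc (0 : ℝ) 1)
    (hqhat : ∀ z : Z, qhat z ∈ Set.Icc (0 : ℝ) 1)
    (D : ℝ) (hD : D = ∑ z : Z, p z * q z) (hDpos : 0 < D)
    (k : ℕ) (hk : k = Fintype.card Z)
    (ε : ℝ) (hε0 : 0 ≤ ε)
    (hpε : ∀ z : Z, |phat z - p z| ≤ ε)
    (hqε : ∀ z : Z, |qhat z - q z| ≤ ε)
    (hεD : ε ≤ D / (4 * k)) :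
    D / 2 ≤ ∑ z : Z, phat z * qhat z ∧
      |(∑ z : Z, val z * phat z * qhat z) / (∑ z' : Z, phat z' * qhat z') -
        (∑ z : Z, val z * p z * q z) / D| ≤ 4 * M * k / D * (1 + k / D) * ε := by
  have hM : 0 ≤ M := (abs_nonneg _).trans (hval (Classical.arbitrary Z))
  have hk0 : (0 : ℝ) < k := by
    rw [hk]; exact_mod_cast Fintype.card_pos
  have hke : 4 * k * ε ≤ D := by
    rw [le_div_iff₀ (by positivity)] at hεD
    linarith
  have hpt : ∀ z, |phat z * qhat z - p z * q z| ≤ 2 * ε := by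
    intro z
    have e : phat z * qhat z - p z * q z
        = (phat z - p z) * qhat z + p z * (qhat z - q z) := by ring
    rw [e]
    refine (abs_add_le _ _).trans ?_
    rw [abs_mul, abs_mul, abs_of_nonneg (hqhat z).1, abs_of_nonneg (hp z).1]
    have h1 := mul_le_mul (hpε z) (hqhat z).2 (hqhat z).1 hε0
    have h2 := mul_le_mul (hp z).2 (hqε z) (abs_nonneg _) zero_le_one
    linarith
  have hsum : ∀ (f : Z → ℝ) (c : ℝ), (∀ z, |f z| ≤ c) → |∑ z, f z| ≤ k * c := by
    intro f c h
    refine (Finset.abs_sum_le_sum_abs _ _).trans ?_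
    refine (Finset.sum_le_sum (fun z _ => h z)).trans ?_
    simp [hk]
  have hDD : |(∑ z, phat z * qhat z) - D| ≤ k * (2 * ε) := by
    rw [hD, ← Finset.sum_sub_distrib]
    exact hsum _ _ hpt
  have hNN : |(∑ z, val z * phat z * qhat z) - ∑ z, val z * p z * q z|
      ≤ k * (M * (2 * ε)) := by
    rw [← Finset.sum_sub_distrib]
    refine hsum _ _ (fun z => ?_)
    have e : val z * phat z * qhat z - val z * p z * q z
        = val z * (phat z * qhat z - p z * q z) := by ring
    rw [e, abs_mul]
    exact mul_le_mul (hval z) (hpt z) (abs_nonneg _) hM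
  have hN : |∑ z, val z * phat z * qhat z| ≤ M * ∑ z, phat z * qhat z := by
    refine (Finset.abs_sum_le_sum_abs _ _).trans ?_
    rw [Finset.mul_sum]
    refine Finset.sum_le_sum (fun z _ => ?_)
    have h0 : 0 ≤ phat z * qhat z := mul_nonneg (hphat z).1 (hqhat z).1
    rw [mul_assoc, abs_mul, abs_of_nonneg h0]
    exact mul_le_mul_of_nonneg_right (hval z) h0
  generalize (∑ z, phat z * qhat z) = E at *
  generalize (∑ z, val z * phat z * qhat z) = A at *
  generalize (∑ z, val z * p z * q z) = B at *
  have hE : D / 2 ≤ E := by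
    have := (abs_le.1 hDD).1
    linarith
  refine ⟨hE, ?_⟩
  have hE0 : 0 < E := by linarith
  have hX : |A / E| ≤ M := by
    rw [abs_div, abs_of_pos hE0, div_le_iff₀ hE0]; exact hN
  have e : A / E - B / D = ((A - B) - (A / E) * (E - D)) / D := by
    field_simp
    ring
  have h1 : |(A - B) - (A / E) * (E - D)| ≤ 4 * M * k * ε := by
    refine (abs_sub _ _).trans ?_
    rw [abs_mul]
    have := mul_le_mul hX hDD (abs_nonneg _) hM
    linarith
  have h2 : |A / E - B / D| ≤ 4 * M * k * ε / D := by
    rw [e, abs_div, abs_of_pos hDpos]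
    exact div_le_div_of_nonneg_right h1 hDpos.le
  refine h2.trans ?_
  have h3 : 0 ≤ 4 * M * k / D * (k / D) * ε := by positivity
  have h4 : 4 * M * k / D * (1 + k / D) * ε
      = 4 * M * k * ε / D + 4 * M * k / D * (k / D) * ε := by ring
  linarith
end

section
/- Let X be a finite nonempty type, P an irreducible and aperiodic transition matrix on X, ν a stationary distribution for P, and x₀ ∈ X. Let (X_t)_{t≥0} be the coordinate process on X^ℕ under the Markov trajectory probability measure started at X_0 = x₀ with one-step transition probabilities P (constructed via the Ionescu–Tulcea theorem from the Markov kernel associated with P). Then for every x ∈ X, the empirical frequency (1/n) · Σ_{i=0}^{n−1} 1[X_i = x] converges in probability to ν x as n → ∞. -/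
open MeasureTheory Filter

lemma aux_pow_nonneg {X : Type*} [Fintype X] [DecidableEq X] (P : Matrix X X ℝ)
    (hnn : ∀ x x' : X, 0 ≤ P x x') (n : ℕ) : ∀ x x', 0 ≤ (P ^ n) x x' := by
  induction n with
  | zero => intro x x'; rw [pow_zero, Matrix.one_apply]; split_ifs <;> norm_num
  | succ k ih =>
    intro x x'
    rw [pow_succ, Matrix.mul_apply]
    exact Finset.sum_nonneg fun z _ => mul_nonneg (ih _ _) (hnn _ _)

lemma aux_pow_fix {X : Type*} [Fintype X] [DecidableEq X] (P : Matrix X X ℝ)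
    (h : X → ℝ) (hh : P.mulVec h = h) (n : ℕ) : (P ^ n).mulVec h = h := by
  induction n with
  | zero => simp
  | succ k ih => rw [pow_succ, ← Matrix.mulVec_mulVec, hh, ih]

lemma aux_harmonic {X : Type*} [Fintype X] [Nonempty X] [DecidableEq X]
    (P : Matrix X X ℝ)
    (hnn : ∀ x x' : X, 0 ≤ P x x')
    (hrow : ∀ x : X, ∑ x' : X, P x x' = 1)
    (hirr : ∀ x x' : X, ∃ n : ℕ, 1 ≤ n ∧ 0 < (P ^ n) x x')
    (h : X → ℝ) (hh : P.mulVec h = h) : ∃ c : ℝ, ∀ x, h x = c := by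
  obtain ⟨y, hy⟩ := Finite.exists_max h
  refine ⟨h y, fun x => ?_⟩
  obtain ⟨n, -, hn⟩ := hirr y x
  have h1 : P.mulVec (fun _ => (1 : ℝ)) = fun _ => 1 := by
    ext z; simp [Matrix.mulVec, dotProduct, hrow]
  have e1 := congrFun (aux_pow_fix P _ h1 n) y
  have e2 := congrFun (aux_pow_fix P h hh n) y
  simp only [Matrix.mulVec, dotProduct, mul_one] at e1 e2
  have e3 : ∑ z, (P ^ n) y z * (h y - h z) = 0 := by
    simp only [mul_sub, Finset.sum_sub_distrib, ← Finset.sum_mul, e1, e2]; ring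
  rw [Finset.sum_eq_zero_iff_of_nonneg] at e3
  · have := e3 x (Finset.mem_univ _)
    rcases mul_eq_zero.1 this with h | h <;> linarith
  · intro z _
    exact mul_nonneg (aux_pow_nonneg P hnn n _ _) (by linarith [hy z])

lemma aux_poisson {X : Type*} [Fintype X] [Nonempty X] [DecidableEq X]
    (P : Matrix X X ℝ)
    (hnn : ∀ x x' : X, 0 ≤ P x x')
    (hrow : ∀ x : X, ∑ x' : X, P x x' = 1)
    (hirr : ∀ x x' : X, ∃ n : ℕ, 1 ≤ n ∧ 0 < (P ^ n) x x')
    (ν : X → ℝ) (hνsum : ∑ x : X, ν x = 1)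
    (hνstat : ∀ x' : X, ∑ x : X, ν x * P x x' = ν x')
    (f : X → ℝ) (hf : ∑ x, ν x * f x = 0) :
    ∃ g : X → ℝ, ∀ x, f x = g x - ∑ y, P x y * g y := by
  let A : (X → ℝ) →ₗ[ℝ] (X → ℝ) := LinearMap.id - P.mulVecLin
  let L : (X → ℝ) →ₗ[ℝ] ℝ := Fintype.linearCombination ℝ ν
  have hL : ∀ v, L v = ∑ x, v x * ν x := fun v => by
    simp [L, Fintype.linearCombination_apply]
  have hA : ∀ v x, A v x = v x - ∑ y, P x y * v y := fun v x => by
    simp [A, Matrix.mulVec, dotProduct]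
  have hker : LinearMap.ker A ≤ Submodule.span ℝ {fun _ => (1 : ℝ)} := by
    intro v hv
    have : P.mulVec v = v := by
      ext x
      have := congrFun (LinearMap.mem_ker.1 hv) x
      rw [hA] at this
      simp only [Matrix.mulVec, dotProduct]
      simp only [Pi.zero_apply] at this
      linarith
    obtain ⟨c, hc⟩ := aux_harmonic P hnn hrow hirr v this
    rw [Submodule.mem_span_singleton]
    exact ⟨c, by ext x; simp [hc]⟩
  have hk1 : Module.finrank ℝ (LinearMap.ker A) ≤ 1 :=
    (Submodule.finrank_mono hker).trans
      ((finrank_span_le_card _).trans (by simp))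
  have hLs : LinearMap.range L = ⊤ := by
    rw [LinearMap.range_eq_top]
    intro c
    exact ⟨fun _ => c, by rw [hL, ← Finset.mul_sum, hνsum, mul_one]⟩
  have d1 := LinearMap.finrank_range_add_finrank_ker A
  have d2 := LinearMap.finrank_range_add_finrank_ker L
  rw [hLs, finrank_top, Module.finrank_self] at d2
  have hle : LinearMap.range A ≤ LinearMap.ker L := by
    rintro _ ⟨v, rfl⟩
    rw [LinearMap.mem_ker, hL]
    simp only [hA, sub_mul, Finset.sum_sub_distrib, Finset.sum_mul]
    rw [Finset.sum_comm, sub_eq_zero]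
    refine Finset.sum_congr rfl fun y _ => ?_
    rw [← hνstat y, Finset.mul_sum]
    exact Finset.sum_congr rfl fun x _ => by ring
  have heq := Submodule.eq_of_le_of_finrank_le hle (by omega)
  have : f ∈ LinearMap.range A := by
    rw [heq, LinearMap.mem_ker, hL, ← hf]
    exact Finset.sum_congr rfl fun x _ => by ring
  obtain ⟨g, hg⟩ := this
  exact ⟨g, fun x => by rw [← hg, hA]⟩

/-- weight of a finite path -/
noncomputable def pathW {X : Type*} [DecidableEq X] (P : Matrix X X ℝ) (x₀ : X) (n : ℕ)
    (c : Fin (n + 1) → X) : ℝ :=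
  (if c 0 = x₀ then (1 : ℝ) else 0) * ∏ i : Fin n, P (c i.castSucc) (c i.succ)

lemma aux_expect {X : Type*} [Fintype X] [DecidableEq X]
    [MeasurableSpace X] [MeasurableSingletonClass X]
    (P : Matrix X X ℝ) (hnn : ∀ x x' : X, 0 ≤ P x x') (x₀ : X)
    (μ : Measure (ℕ → X)) [IsProbabilityMeasure μ]
    (hμ : ∀ (n : ℕ) (f : ℕ → X),
      μ {ω : ℕ → X | ∀ i ≤ n, ω i = f i} =
        ENNReal.ofReal
          ((if f 0 = x₀ then (1 : ℝ) else 0) * ∏ i ∈ Finset.range n, P (f i) (f (i + 1))))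
    (n : ℕ) (H : (Fin (n + 1) → X) → ℝ) :
    ∫ ω, H (fun i => ω i) ∂μ = ∑ c, pathW P x₀ n c * H c := by
  have hm : Measurable (fun (ω : ℕ → X) (i : Fin (n + 1)) => ω i) := by fun_prop
  have hH : Measurable H := measurable_of_finite H
  haveI : IsProbabilityMeasure (μ.map (fun (ω : ℕ → X) (i : Fin (n + 1)) => ω i)) :=
    Measure.isProbabilityMeasure_map hm.aemeasurable
  rw [← integral_map (φ := fun (ω : ℕ → X) (i : Fin (n + 1)) => ω i) (f := H) hm.aemeasurable
    hH.aestronglyMeasurable]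
  rw [integral_fintype (Integrable.of_finite)]
  refine Finset.sum_congr rfl fun c _ => ?_
  rw [smul_eq_mul]
  congr 1
  rw [measureReal_def, Measure.map_apply hm (measurableSet_singleton _)]
  have key := hμ n (fun i => if h : i < n + 1 then c ⟨i, h⟩ else x₀)
  have hset : (fun (ω : ℕ → X) (i : Fin (n + 1)) => ω i) ⁻¹' {c} =
      {ω : ℕ → X | ∀ i ≤ n, ω i = if h : i < n + 1 then c ⟨i, h⟩ else x₀} := by
    ext ω
    simp only [Set.mem_preimage, Set.mem_singleton_iff, Set.mem_setOf_eq, funext_iff]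
    constructor
    · intro h i hi
      rw [dif_pos (by omega), ← h]
    · intro h i
      rw [h i (by omega), dif_pos i.2]
  rw [hset, key, ENNReal.toReal_ofReal]
  · rw [pathW, Finset.prod_range]
    congr 1
    refine Finset.prod_congr rfl fun i _ => ?_
    have h1 : (i : ℕ) < n + 1 := by omega
    have h2 : (i : ℕ) + 1 < n + 1 := by omega
    rw [dif_pos h1, dif_pos h2]
    rfl
  · refine mul_nonneg (by split_ifs <;> norm_num) (Finset.prod_nonneg fun i _ => hnn _ _)

lemma aux_orth {X : Type*} [Fintype X] [DecidableEq X]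
    [MeasurableSpace X] [MeasurableSingletonClass X]
    (P : Matrix X X ℝ) (hnn : ∀ x x' : X, 0 ≤ P x x')
    (hrow : ∀ x : X, ∑ x' : X, P x x' = 1) (x₀ : X)
    (μ : Measure (ℕ → X)) [IsProbabilityMeasure μ]
    (hμ : ∀ (n : ℕ) (f : ℕ → X),
      μ {ω : ℕ → X | ∀ i ≤ n, ω i = f i} =
        ENNReal.ofReal
          ((if f 0 = x₀ then (1 : ℝ) else 0) * ∏ i ∈ Finset.range n, P (f i) (f (i + 1))))
    (g : X → ℝ) (n : ℕ) (F : (Fin (n + 1) → X) → ℝ) :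
    ∫ ω, F (fun i => ω i) * (g (ω (n + 1)) - ∑ y, P (ω n) y * g y) ∂μ = 0 := by
  have := aux_expect P hnn x₀ μ hμ (n + 1)
    (fun c => F (fun i => c i.castSucc) *
      (g (c (Fin.last (n + 1))) - ∑ y, P (c (Fin.last n).castSucc) y * g y))
  simp only [Fin.val_castSucc, Fin.val_last] at this
  rw [this, ← (Fin.snocEquiv (fun _ : Fin (n + 2) => X)).sum_comp, Fintype.sum_prod_type,
    Finset.sum_comm]
  refine Finset.sum_eq_zero fun c _ => ?_
  have hw : ∀ y, pathW P x₀ (n + 1) (Fin.snoc (α := fun _ => X) c y)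
      = pathW P x₀ n c * P (c (Fin.last n)) y := by
    intro y
    have h0 : Fin.snoc (α := fun _ => X) c y 0 = c 0 := by
      have := Fin.snoc_castSucc (α := fun _ => X) y c 0
      simpa using this
    rw [pathW, pathW, h0, Fin.prod_univ_castSucc]
    simp only [Fin.snoc_castSucc, Fin.succ_last, Fin.snoc_last, ← Fin.castSucc_succ]
    ring
  simp only [Fin.snocEquiv, Equiv.coe_fn_mk, hw, Fin.snoc_castSucc, Fin.snoc_last]
  have : ∀ y, pathW P x₀ n c * P (c (Fin.last n)) y *
      (F c * (g y - ∑ z, P (c (Fin.last n)) z * g z)) = pathW P x₀ n c * F c *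
      (P (c (Fin.last n)) y * g y) - pathW P x₀ n c * F c * (∑ z, P (c (Fin.last n)) z * g z) *
        P (c (Fin.last n)) y := fun y => by ring
  simp only [this, Finset.sum_sub_distrib, ← Finset.mul_sum, hrow]
  ring

lemma aux_integrable {X : Type*} [Fintype X] 
    [MeasurableSpace X] [MeasurableSingletonClass X]
    (μ : Measure (ℕ → X)) [IsProbabilityMeasure μ] (n : ℕ) (H : (Fin n → X) → ℝ) :
    Integrable (fun ω => H (fun i => ω i)) μ := by
  have hm : Measurable (fun (ω : ℕ → X) (i : Fin n) => ω i) := by fun_prop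
  have hH : Measurable H := measurable_of_finite H
  exact (Integrable.of_finite (f := H)
    (μ := μ.map (fun (ω : ℕ → X) (i : Fin n) => ω i))).comp_measurable hm

lemma aux_second {X : Type*} [Fintype X] [DecidableEq X]
    [MeasurableSpace X] [MeasurableSingletonClass X]
    (P : Matrix X X ℝ) (hnn : ∀ x x' : X, 0 ≤ P x x')
    (hrow : ∀ x : X, ∑ x' : X, P x x' = 1) (x₀ : X)
    (μ : Measure (ℕ → X)) [IsProbabilityMeasure μ]
    (hμ : ∀ (n : ℕ) (f : ℕ → X),
      μ {ω : ℕ → X | ∀ i ≤ n, ω i = f i} =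
        ENNReal.ofReal
          ((if f 0 = x₀ then (1 : ℝ) else 0) * ∏ i ∈ Finset.range n, P (f i) (f (i + 1))))
    (g : X → ℝ) (K : ℝ) (hK : ∀ x z, (g z - ∑ y, P x y * g y) ^ 2 ≤ K) (n : ℕ) :
    Integrable (fun ω : ℕ → X =>
      (∑ i ∈ Finset.range n, (g (ω (i + 1)) - ∑ y, P (ω i) y * g y)) ^ 2) μ ∧
    ∫ ω : ℕ → X, (∑ i ∈ Finset.range n, (g (ω (i + 1)) - ∑ y, P (ω i) y * g y)) ^ 2 ∂μ
      ≤ n * K := by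
  have hI : ∀ n, Integrable (fun ω : ℕ → X =>
      (∑ i ∈ Finset.range n, (g (ω (i + 1)) - ∑ y, P (ω i) y * g y)) ^ 2) μ := by
    intro n
    have := aux_integrable μ (n + 1) (fun c => (∑ i : Fin n, (g (c i.succ) -
      ∑ y, P (c i.castSucc) y * g y)) ^ 2)
    simpa [Finset.sum_range] using this
  refine ⟨hI n, ?_⟩
  induction n with
  | zero => simp
  | succ n ih =>
    have ho := aux_orth P hnn hrow x₀ μ hμ g n (fun c => (∑ i : Fin n, (g (c i.succ) -
      ∑ y, P (c i.castSucc) y * g y)))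
    have hi2 := aux_integrable μ (n + 2) (fun c => (∑ i : Fin n, (g (c i.succ.castSucc) -
      ∑ y, P (c i.castSucc.castSucc) y * g y)) * (g (c (Fin.last (n + 1))) -
        ∑ y, P (c (Fin.last n).castSucc) y * g y))
    have hi3 := aux_integrable μ (n + 2) (fun c => (g (c (Fin.last (n + 1))) -
        ∑ y, P (c (Fin.last n).castSucc) y * g y) ^ 2)
    simp only [Fin.val_castSucc, Fin.val_last, Fin.val_succ] at ho hi2 hi3
    have hs : ∀ ω : ℕ → X, ∑ i : Fin n, (g (ω (i + 1)) - ∑ y, P (ω i) y * g y) =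
        ∑ i ∈ Finset.range n, (g (ω (i + 1)) - ∑ y, P (ω i) y * g y) := fun ω =>
      (Finset.sum_range (fun i => g (ω (i + 1)) - ∑ y, P (ω i) y * g y)).symm
    simp only [hs] at ho hi2
    have e : ∀ ω : ℕ → X,
        (∑ i ∈ Finset.range (n + 1), (g (ω (i + 1)) - ∑ y, P (ω i) y * g y)) ^ 2 =
        ((∑ i ∈ Finset.range n, (g (ω (i + 1)) - ∑ y, P (ω i) y * g y)) ^ 2 +
        2 * ((∑ i ∈ Finset.range n, (g (ω (i + 1)) - ∑ y, P (ω i) y * g y)) *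
          (g (ω (n + 1)) - ∑ y, P (ω n) y * g y))) +
        (g (ω (n + 1)) - ∑ y, P (ω n) y * g y) ^ 2 := by
      intro ω; rw [Finset.sum_range_succ]; ring
    simp only [e]
    have hadd : Integrable (fun ω : ℕ → X =>
        (∑ i ∈ Finset.range n, (g (ω (i + 1)) - ∑ y, P (ω i) y * g y)) ^ 2 +
        2 * ((∑ i ∈ Finset.range n, (g (ω (i + 1)) - ∑ y, P (ω i) y * g y)) *
          (g (ω (n + 1)) - ∑ y, P (ω n) y * g y))) μ := (hI n).add (hi2.const_mul 2)
    rw [integral_add hadd hi3, integral_add (hI n) (hi2.const_mul 2),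
      integral_const_mul, ho]
    have : ∫ ω : ℕ → X, (g (ω (n + 1)) - ∑ y, P (ω n) y * g y) ^ 2 ∂μ ≤ ∫ ω : ℕ → X, K ∂μ :=
      integral_mono hi3 (integrable_const _) (fun ω => hK _ _)
    simp only [integral_const, probReal_univ, one_smul] at this
    push_cast
    linarith

/-- Law of large numbers for the empirical state frequencies of a finite irreducible
aperiodic Markov chain: if `μ` is the trajectory law on `ℕ → X` of the chain with
transition matrix `P` started at `x₀` (characterized by its cylinder probabilities,
as produced by the Ionescu–Tulcea construction), and `ν` is a stationary distribution
for `P`, then for every state `x` the empirical frequency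
`(1/n) ∑_{i=0}^{n-1} 1[Xᵢ = x]` converges in probability to `ν x`. -/
theorem stmt_16 {X : Type*} [Fintype X] [Nonempty X] [DecidableEq X]
    [MeasurableSpace X] [MeasurableSingletonClass X]
    (P : Matrix X X ℝ)
    (hnn : ∀ x x' : X, 0 ≤ P x x')
    (hrow : ∀ x : X, ∑ x' : X, P x x' = 1)
    (hirr : ∀ x x' : X, ∃ n : ℕ, 1 ≤ n ∧ 0 < (P ^ n) x x')
    (hap : ∀ x : X, setGcd {n : ℕ | 1 ≤ n ∧ 0 < (P ^ n) x x} = 1)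
    (ν : X → ℝ) (hνnn : ∀ x : X, 0 ≤ ν x) (hνsum : ∑ x : X, ν x = 1)
    (hνstat : ∀ x' : X, ∑ x : X, ν x * P x x' = ν x')
    (x₀ : X)
    (μ : Measure (ℕ → X)) [IsProbabilityMeasure μ]
    (hμ : ∀ (n : ℕ) (f : ℕ → X),
      μ {ω : ℕ → X | ∀ i ≤ n, ω i = f i} =
        ENNReal.ofReal
          ((if f 0 = x₀ then (1 : ℝ) else 0) * ∏ i ∈ Finset.range n, P (f i) (f (i + 1)))) :
    ∀ x : X, ∀ ε : ℝ, 0 < ε →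
      Tendsto
        (fun n : ℕ =>
          μ {ω : ℕ → X |
              ε ≤ |(1 / (n : ℝ)) * (∑ i ∈ Finset.range n, if ω i = x then (1 : ℝ) else 0)
                    - ν x|})
        atTop (nhds 0) := by
  intro x ε hε
  obtain ⟨g, hg⟩ := aux_poisson P hnn hrow hirr ν hνsum hνstat
    (fun z => (if z = x then (1 : ℝ) else 0) - ν x) (by
      simp [mul_sub, Finset.sum_sub_distrib, ← Finset.sum_mul, hνsum])
  obtain ⟨⟨a, b⟩, hK⟩ := Finite.exists_max
    (fun p : X × X => (g p.2 - ∑ y, P p.1 y * g y) ^ 2)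
  obtain ⟨⟨a', b'⟩, hB⟩ := Finite.exists_max (fun p : X × X => (g p.1 - g p.2) ^ 2)
  simp only [Prod.forall] at hK hB
  set K := (g b - ∑ y, P a y * g y) ^ 2
  set B := (g a' - g b') ^ 2
  have hsec := aux_second P hnn hrow x₀ μ hμ g K hK
  have hS : ∀ (n : ℕ) (ω : ℕ → X),
      ∑ i ∈ Finset.range n, ((if ω i = x then (1 : ℝ) else 0) - ν x) =
      (g (ω 0) - g (ω n)) + ∑ i ∈ Finset.range n, (g (ω (i + 1)) - ∑ y, P (ω i) y * g y) := by
    intro n ω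
    rw [← Finset.sum_range_sub' (fun i => g (ω i)), ← Finset.sum_add_distrib]
    refine Finset.sum_congr rfl fun i _ => ?_
    rw [hg]; ring
  have hbound : ∀ n : ℕ, 0 < n → μ {ω : ℕ → X |
              ε ≤ |(1 / (n : ℝ)) * (∑ i ∈ Finset.range n, if ω i = x then (1 : ℝ) else 0)
                    - ν x|} ≤ ENNReal.ofReal ((2 * B / ε ^ 2) * ((n : ℝ)⁻¹ * (n : ℝ)⁻¹) +
                      (2 * K / ε ^ 2) * (n : ℝ)⁻¹) := by
    intro n hn
    have hn' : (0 : ℝ) < n := by exact_mod_cast hn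
    obtain ⟨hi, hle⟩ := hsec n
    have hY : Integrable (fun ω : ℕ → X => 2 * B + 2 *
      (∑ i ∈ Finset.range n, (g (ω (i + 1)) - ∑ y, P (ω i) y * g y)) ^ 2) μ :=
      (integrable_const _).add (hi.const_mul 2)
    have hmk := mul_meas_ge_le_integral_of_nonneg
      (Eventually.of_forall fun ω => by positivity) hY ((n * ε) ^ 2)
    rw [integral_add (integrable_const _) (hi.const_mul 2)] at hmk
    simp only [integral_const_mul, integral_const, probReal_univ, one_smul] at hmk
    rw [← ofReal_measureReal]
    apply ENNReal.ofReal_le_ofReal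
    have hmono : μ.real {ω : ℕ → X |
              ε ≤ |(1 / (n : ℝ)) * (∑ i ∈ Finset.range n, if ω i = x then (1 : ℝ) else 0)
                    - ν x|} ≤ μ.real {ω : ℕ → X | (n * ε) ^ 2 ≤ 2 * B + 2 *
      (∑ i ∈ Finset.range n, (g (ω (i + 1)) - ∑ y, P (ω i) y * g y)) ^ 2} := by
      refine measureReal_mono ?_
      intro ω hω
      simp only [Set.mem_setOf_eq] at hω ⊢
      have h1 := hS n ω
      rw [Finset.sum_sub_distrib, Finset.sum_const, Finset.card_range, nsmul_eq_mul] at h1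
      have h2 : (1 / (n : ℝ)) * (∑ i ∈ Finset.range n, if ω i = x then (1 : ℝ) else 0) - ν x
        = ((∑ i ∈ Finset.range n, if ω i = x then (1 : ℝ) else 0) - n * ν x) / n := by
        field_simp
      rw [h2, abs_div, abs_of_pos hn', le_div_iff₀ hn', h1] at hω
      have h3 := pow_le_pow_left₀ (by positivity) hω 2
      rw [sq_abs] at h3
      have h4 := hB (ω 0) (ω n)
      set M := ∑ i ∈ Finset.range n, (g (ω (i + 1)) - ∑ y, P (ω i) y * g y)
      nlinarith [sq_nonneg (g (ω 0) - g (ω n) - M)]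
    have hpos : (0 : ℝ) < (n * ε) ^ 2 := by positivity
    have h5 : (n * ε) ^ 2 * μ.real {ω : ℕ → X |
              ε ≤ |(1 / (n : ℝ)) * (∑ i ∈ Finset.range n, if ω i = x then (1 : ℝ) else 0)
                    - ν x|} ≤ 2 * B + 2 * (n * K) := by
      refine (mul_le_mul_of_nonneg_left hmono hpos.le).trans (hmk.trans ?_)
      linarith
    rw [← le_div_iff₀' hpos] at h5
    refine h5.trans (le_of_eq ?_)
    field_simp
  have hlim : Tendsto (fun n : ℕ => ENNReal.ofReal ((2 * B / ε ^ 2) * ((n : ℝ)⁻¹ * (n : ℝ)⁻¹) +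
                      (2 * K / ε ^ 2) * (n : ℝ)⁻¹)) atTop (nhds 0) := by
    have h0 : Tendsto (fun n : ℕ => (n : ℝ)⁻¹) atTop (nhds 0) := tendsto_inv_atTop_nhds_zero_nat
    have := ENNReal.tendsto_ofReal
      (((h0.mul h0).const_mul (2 * B / ε ^ 2)).add (h0.const_mul (2 * K / ε ^ 2)))
    simpa using this
  refine tendsto_of_tendsto_of_tendsto_of_le_of_le' tendsto_const_nhds hlim
    (Eventually.of_forall fun _ => zero_le) ?_
  filter_upwards [eventually_gt_atTop 0] with n hn using hbound n hn
end
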